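/- arXiv:2309.05522 — 3 statements merged into one kernel-verified Lean document; each statement's English description precedes it below -/
import Mathlib

section
/- Let N=1 and p>1. There exists a constant C_p > 0, depending only on p, such that for every ρ ∈ A one has 𝒲_p(χ_B)^p − 𝒲_p(ρ)^p ≥ C_p · A(ρ)², where B ⊂ ℝ is an interval of length 1. -/
open MeasureTheory ENNReal Set Metric Filter

noncomputable section

/-- Euclidean space `ℝ^N`. -/
abbrev Euc (N : ℕ) := EuclideanSpace ℝ (Fin N)

/-- The measure `ρ·γ` with density `ρ` with respect to `γ`. -/
def densM {α : Type*} [MeasurableSpace α] (γ : Measure α) (ρ : α → ℝ) : Measure α :=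
  γ.withDensity fun x => ENNReal.ofReal (ρ x)

/-- `π` is a transport plan (coupling) with marginals `μ` and `ν`. -/
def IsCoupling {α : Type*} [MeasurableSpace α] (π : Measure (α × α)) (μ ν : Measure α) : Prop :=
  π.map Prod.fst = μ ∧ π.map Prod.snd = ν

/-- Transport cost `∬ d(x,y)^p dπ(x,y)`. -/
def tCost {α : Type*} [MeasurableSpace α] [Dist α] (p : ℝ) (π : Measure (α × α)) : ℝ≥0∞ :=
  ∫⁻ z, ENNReal.ofReal (dist z.1 z.2 ^ p) ∂π

/-- The `p`-th power `W_p(μ,ν)^p` of the `p`-Wasserstein distance. -/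
def WpPow {α : Type*} [MeasurableSpace α] [Dist α] (p : ℝ) (μ ν : Measure α) : ℝ≥0∞ :=
  ⨅ (π : Measure (α × α)) (_ : IsCoupling π μ ν), tCost p π

/-- The `p`-Wasserstein distance `W_p(μ,ν)`. -/
def Wp {α : Type*} [MeasurableSpace α] [Dist α] (p : ℝ) (μ ν : Measure α) : ℝ≥0∞ :=
  WpPow p μ ν ^ (1 / p)

/-- `ρ'` is an admissible competitor for the energy `𝒲_p(ρ)`:
measurable, nonnegative, `ρ + ρ' ≤ 1` a.e., same total mass as `ρ`. -/
def Adm {α : Type*} [MeasurableSpace α] (γ : Measure α) (ρ ρ' : α → ℝ) : Prop :=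
  Measurable ρ' ∧ (∀ x, 0 ≤ ρ' x) ∧ (∀ᵐ x ∂γ, ρ x + ρ' x ≤ 1) ∧
    ∫⁻ x, ENNReal.ofReal (ρ' x) ∂γ = ∫⁻ x, ENNReal.ofReal (ρ x) ∂γ

/-- The `p`-th power `𝒲_p(ρ)^p` of the Wasserstein energy of a density `ρ`. -/
def WEnergyPow {α : Type*} [MeasurableSpace α] [Dist α] (p : ℝ) (γ : Measure α) (ρ : α → ℝ) :
    ℝ≥0∞ :=
  ⨅ (ρ' : α → ℝ) (_ : Adm γ ρ ρ'), WpPow p (densM γ ρ) (densM γ ρ')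

/-- The Wasserstein energy `𝒲_p(ρ) = inf { W_p(ργ, ρ'γ) : ρ' admissible }`. -/
def WEnergy {α : Type*} [MeasurableSpace α] [Dist α] (p : ℝ) (γ : Measure α) (ρ : α → ℝ) :
    ℝ≥0∞ :=
  WEnergyPow p γ ρ ^ (1 / p)

/-- The class `A_m` of densities with values in `[0,1]` and total mass `m`. -/
def memA {α : Type*} [MeasurableSpace α] (γ : Measure α) (m : ℝ) (ρ : α → ℝ) : Prop :=
  Measurable ρ ∧ (∀ᵐ x ∂γ, 0 ≤ ρ x ∧ ρ x ≤ 1) ∧ ∫ x, ρ x ∂γ = m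

/-- The class `AP_ρ` of admissible plans: first marginal `ργ`, second marginal `≤ (1-ρ)γ`. -/
def AP {α : Type*} [MeasurableSpace α] (γ : Measure α) (ρ : α → ℝ) (π : Measure (α × α)) : Prop :=
  π.map Prod.fst = densM γ ρ ∧ π.map Prod.snd ≤ densM γ fun x => 1 - ρ x

/-- `z` belongs to the support of the measure `μ`. -/
def inSupport {α : Type*} [TopologicalSpace α] [MeasurableSpace α] (μ : Measure α) (z : α) :
    Prop :=
  ∀ U : Set α, IsOpen U → z ∈ U → 0 < μ U

/-- The asymmetry of a density on `ℝ`: the infimal `L¹` distance to characteristic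
functions of intervals of length `1`. -/
def asym (ρ : ℝ → ℝ) : ℝ :=
  ⨅ x : ℝ, ∫ y, |ρ y - (Set.Ioo (x - 1/2) (x + 1/2)).indicator (fun _ => (1 : ℝ)) y|

lemma exists_map_aux (R : ℝ → ℝ) (hR : Monotone R) (hV : Monotone fun x => x - R x)
    (hc : Continuous R) (R0 : R 0 = 0) (hR1 : ∀ x, R x ≤ 1 / 2) :
    ∃ T k : ℝ → ℝ, Monotone T ∧ (∀ x, 0 ≤ x → 0 ≤ T x) ∧ (∀ x, 0 ≤ x → T x - R (T x) = k x) ∧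
      (∀ x x', 0 ≤ x → x ≤ x' → R x' - R x ≤ k x' - k x) ∧
      (∀ x, 0 ≤ x → x - 1 / 4 - R (x - 1 / 4) ≤ k x) ∧
      (∀ x, 0 ≤ x → |x - T x| ≤ 1 / 2) ∧
      (∀ x, 0 ≤ x → R x < 1 / 2 - R (1 / 2) → |x - T x| ≤ 1 / 2 - (1 / 2 - R (1 / 2)) / 2) := by
  have hVc : Continuous fun x => x - R x := by fun_prop
  set f : ℝ → ℝ := fun z => max 0 (z - 1 / 4 - R (z - 1 / 4) - R z) with hf
  have hfc : Continuous f := by fun_prop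
  set M : ℝ → ℝ := fun x => sSup (f '' Icc 0 x) with hM
  have hMa : ∀ x, 0 ≤ x → ∃ z ∈ Icc 0 x, M x = f z ∧ ∀ y ∈ Icc 0 x, f y ≤ f z := fun x hx =>
    isCompact_Icc.exists_sSup_image_eq_and_ge ⟨0, by simp [hx]⟩ hfc.continuousOn
  set k : ℝ → ℝ := fun x => R x + M x with hk
  have hMmono : ∀ x x', 0 ≤ x → x ≤ x' → M x ≤ M x' := by
    intro x x' hx hxx
    obtain ⟨z, hz, h1, -⟩ := hMa x hx
    obtain ⟨z', hz', h1', h2'⟩ := hMa x' (hx.trans hxx)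
    rw [h1, h1']
    exact h2' z ⟨hz.1, hz.2.trans hxx⟩
  have hM0 : ∀ x, 0 ≤ x → 0 ≤ M x := by
    intro x hx
    obtain ⟨z, hz, h1, -⟩ := hMa x hx
    rw [h1]; exact le_max_left _ _
  have hkk : ∀ x x', 0 ≤ x → x ≤ x' → R x' - R x ≤ k x' - k x := by
    intro x x' hx hxx
    have := hMmono x x' hx hxx
    simp only [hk]; linarith
  have hk0 : ∀ x, 0 ≤ x → 0 ≤ k x := by
    intro x hx
    have := hM0 x hx
    have := hR hx
    simp only [hk]; linarith
  have hkl : ∀ x, 0 ≤ x → x - 1 / 4 - R (x - 1 / 4) ≤ k x := by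
    intro x hx
    obtain ⟨z, hz, h1, h2⟩ := hMa x hx
    have h3 := h2 x ⟨hx, le_rfl⟩
    have h4 : x - 1 / 4 - R (x - 1 / 4) - R x ≤ f x := le_max_right _ _
    simp only [hk]; linarith
  have hkm : ∀ x x', 0 ≤ x → x ≤ x' → k x ≤ k x' := by
    intro x x' hx hxx
    have := hkk x x' hx hxx
    have := hR hxx
    linarith
  -- inverse
  have hinv : ∀ x, 0 ≤ x → ∃ y, 0 ≤ y ∧ y - R y = k x ∧ ∀ a, 0 ≤ a → a - R a ≤ k x → a ≤ y := by
    intro x hx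
    set S : Set ℝ := {y | 0 ≤ y ∧ y - R y = k x} with hS
    have hSa : ∀ a, 0 ≤ a → a - R a ≤ k x → ∃ y ∈ S, a ≤ y := by
      intro a ha hak
      have hb : a ≤ max a (k x + 1 / 2) := le_max_left _ _
      have hb2 : k x + 1 / 2 ≤ max a (k x + 1 / 2) := le_max_right _ _
      obtain ⟨y, hy, hyk⟩ := intermediate_value_Icc hb hVc.continuousOn
        (show k x ∈ Icc _ _ from ⟨hak, by
          have := hR1 (max a (k x + 1 / 2))
          linarith⟩)
      exact ⟨y, ⟨ha.trans hy.1, hyk⟩, hy.1⟩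
    have hne : S.Nonempty := by
      obtain ⟨y, hy, -⟩ := hSa 0 le_rfl (by rw [R0]; simpa using hk0 x hx)
      exact ⟨y, hy⟩
    have hbd : BddAbove S := ⟨k x + 1 / 2, by
      rintro y ⟨hy, hy2⟩
      have := hR1 y
      linarith⟩
    have hcl : IsClosed S := by
      have : S = Ici 0 ∩ (fun y => y - R y) ⁻¹' {k x} := by ext; simp [hS]
      rw [this]
      exact isClosed_Ici.inter (isClosed_singleton.preimage hVc)
    have hmem := hcl.csSup_mem hne hbd
    refine ⟨sSup S, hmem.1, hmem.2, ?_⟩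
    intro a ha hak
    obtain ⟨y, hy, hay⟩ := hSa a ha hak
    exact hay.trans (le_csSup hbd hy)
  have hinv' : ∀ x, ∃ y, 0 ≤ x → (0 ≤ y ∧ y - R y = k x ∧ ∀ a, 0 ≤ a → a - R a ≤ k x → a ≤ y) := by
    intro x
    by_cases hx : 0 ≤ x
    · obtain ⟨y, hy⟩ := hinv x hx
      exact ⟨y, fun _ => hy⟩
    · exact ⟨0, fun h => absurd h hx⟩
  choose T hT using hinv'
  have key : ∀ x, 0 ≤ x → -(1/4) ≤ T x - x ∧ T x - x ≤ 1 / 2 ∧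
      (R x < 1 / 2 - R (1 / 2) → T x - x ≤ 1 / 2 - (1 / 2 - R (1 / 2)) / 2) := by
    intro x hx
    obtain ⟨hy0, hyk, hya⟩ := hT x hx
    have hRx : 0 ≤ R x := R0 ▸ hR hx
    have hRh : 0 ≤ R (1/2) := R0 ▸ hR (by norm_num)
    have hVx : 0 ≤ x - R x := by
      have := hV hx
      simpa [R0] using this
    refine ⟨?_, ?_⟩
    · rcases le_total (1/4) x with h | h
      · have := hya (x - 1/4) (by linarith) (hkl x hx)
        linarith
      · linarith
    · obtain ⟨z, hz, h1, -⟩ := hMa x hx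
      have hkx : k x = R x + f z := by simp only [hk, h1]
      have hRy := hR1 (T x)
      by_cases hfz : z - 1 / 4 - R (z - 1 / 4) - R z ≤ 0
      · have : f z = 0 := max_eq_left hfz
        refine ⟨by linarith, fun he => ?_⟩
        have hlt : T x ≤ 1 / 2 := by
          by_contra hcon
          have h5 := hV (le_of_lt (not_le.1 hcon))
          simp only at h5
          linarith
        have := hR hlt
        have := hR1 (1/2)
        linarith
      · have hfz' : f z = z - 1 / 4 - R (z - 1 / 4) - R z := max_eq_right (le_of_lt (not_le.1 hfz))
        have hRz : 0 ≤ R z := R0 ▸ hR hz.1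
        have hz4 : 0 ≤ z - 1/4 := by
          by_contra hcon
          have h5 := hV (le_of_lt (not_le.1 hcon))
          simp only [R0] at h5
          linarith
        have h6 : 0 ≤ R (z - 1/4) := R0 ▸ hR hz4
        have h7 := hV hz.2
        simp only at h7
        constructor
        · linarith
        · intro _; linarith
  refine ⟨fun x => T (max x 0), k, ?_, ?_, ?_, hkk, hkl, ?_, ?_⟩
  · intro x x' hxx
    have h1 : max x 0 ≤ max x' 0 := max_le_max hxx le_rfl
    have h0 : 0 ≤ max x 0 := le_max_right _ _
    refine (hT _ (h0.trans h1)).2.2 _ (hT _ h0).1 ?_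
    rw [(hT _ h0).2.1]
    exact hkm _ _ h0 h1
  · intro x hx
    exact (hT _ (le_max_right _ _)).1
  · intro x hx
    simp only [max_eq_left hx]
    exact (hT _ hx).2.1
  · intro x hx
    simp only [max_eq_left hx]
    have := key x hx
    rw [abs_le]; constructor <;> linarith [this.1, this.2.1]
  · intro x hx he
    simp only [max_eq_left hx]
    have h1 := key x hx
    have h2 := h1.2.2 he
    have hRh : 0 ≤ R (1/2) := R0 ▸ hR (by norm_num)
    rw [abs_le]; constructor <;> linarith [h1.1]

lemma measure_le_stieltjes (μ : Measure ℝ) (f : StieltjesFunction ℝ)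
    (h : ∀ a b, a ≤ b → μ (Ioc a b) ≤ ENNReal.ofReal (f b - f a)) : μ ≤ f.measure := by
  rw [Measure.le_iff]
  intro s hs
  have h1 : μ.toOuterMeasure ≤ f.outer := by
    rw [StieltjesFunction.outer, OuterMeasure.le_ofFunction]
    intro s
    rw [StieltjesFunction.length_eq]
    refine le_iInf fun a => le_iInf fun b => le_iInf fun hs => ?_
    have : s ⊆ Ioc a b := by
      refine fun x hx => hs ⟨hx, ?_⟩
      intro (hb : IsBot x)
      have := hb (x - 1)
      linarith
    rcases le_total a b with hab | hab
    · exact (measure_mono this).trans (h a b hab)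
    · rw [Ioc_eq_empty (by linarith)] at this
      rw [subset_empty_iff.1 this]; simp
  have h2 : f.measure s = f.outer s := by
    rw [StieltjesFunction.measure]; rfl
  rw [h2]
  exact h1 s

lemma side_aux (p : ℝ) (hp : 1 < p) (ρ : ℝ → ℝ) (hm : Measurable ρ) (h0 : ∀ x, 0 ≤ ρ x)
    (h1 : ∀ x, ρ x ≤ 1) (hi : Integrable ρ) (hh : ∫ x in Ioi (0:ℝ), ρ x = 1 / 2) :
    ∃ π : Measure (ℝ × ℝ), π.map Prod.fst = (densM volume ρ).restrict (Ioi 0) ∧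
      π.map Prod.snd ≤ (densM volume fun x => 1 - ρ x).restrict (Ioi 0) ∧
      tCost p π + ENNReal.ofReal (2 ^ (-p) * (1/2 - ∫ x in (0:ℝ)..1/2, ρ x) ^ 2 / 2) ≤
        ENNReal.ofReal (2 ^ (-p) / 2) := by
  set R : ℝ → ℝ := fun x => ∫ y in (0:ℝ)..x, ρ y with hRdef
  have hii : ∀ a b, IntervalIntegrable ρ volume a b := fun a b => hi.intervalIntegrable
  have hRsub : ∀ a b, R b - R a = ∫ y in a..b, ρ y := fun a b =>
    intervalIntegral.integral_interval_sub_left (hii _ _) (hii _ _)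
  have hR : Monotone R := by
    intro a b hab
    have := hRsub a b
    have h2 := intervalIntegral.integral_nonneg (μ := volume) hab (fun x _ => h0 x)
    linarith
  have hVsub : ∀ a b, (b - R b) - (a - R a) = ∫ y in a..b, (1 - ρ y) := by
    intro a b
    rw [intervalIntegral.integral_sub (by simp) (hii _ _), ← hRsub]
    simp; ring
  have hV : Monotone fun x => x - R x := by
    intro a b hab
    have := hVsub a b
    have h2 := intervalIntegral.integral_nonneg (μ := volume) (f := fun y => 1 - ρ y) hab
      (fun x _ => by have := h1 x; linarith)
    simp only; linarith
  have hc : Continuous R := intervalIntegral.continuous_primitive hii 0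
  have R0 : R 0 = 0 := by simp [hRdef]
  have hlim : Tendsto R atTop (nhds (1/2)) := by
    rw [← hh]
    exact intervalIntegral_tendsto_integral_Ioi 0 hi.integrableOn tendsto_id
  have hR1 : ∀ x, R x ≤ 1 / 2 := fun x => hR.ge_of_tendsto hlim x
  obtain ⟨T, k, hTm, hT0, hTk, hkk, hkl, hd, hde⟩ := exists_map_aux R hR hV hc R0 hR1
  have hTmeas : Measurable T := hTm.measurable
  set μ : Measure ℝ := (densM volume ρ).restrict (Ioi 0) with hμ
  -- measure of intervals
  have hμI : ∀ a b, 0 ≤ a → a ≤ b → densM volume ρ (Ioc a b) = ENNReal.ofReal (R b - R a) := by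
    intro a b ha hab
    rw [densM, withDensity_apply _ measurableSet_Ioc, hRsub, intervalIntegral.integral_of_le hab,
      ofReal_integral_eq_lintegral_ofReal hi.integrableOn (Eventually.of_forall h0)]
  have hμtot : μ univ = ENNReal.ofReal (1/2) := by
    rw [hμ, Measure.restrict_apply_univ, densM, withDensity_apply _ measurableSet_Ioi, ← hh,
      ofReal_integral_eq_lintegral_ofReal hi.integrableOn (Eventually.of_forall h0)]
  set e : ℝ := 1/2 - R (1/2) with he
  have he0 : 0 ≤ e := by have := hR1 (1/2); linarith
  have he1 : e ≤ 1/2 := by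
    have : 0 ≤ R (1/2) := R0 ▸ hR (by norm_num)
    linarith
  have c0 : (0:ℝ) < 2 ^ (-p) := by positivity
  -- the level b
  obtain ⟨b, hb0, hb⟩ : ∃ b, 0 ≤ b ∧ R b = e / 2 := by
    have : ∀ᶠ x in atTop, 1/4 < R x := hlim.eventually (lt_mem_nhds (by norm_num))
    obtain ⟨B, hB, hB0⟩ := (this.and (eventually_ge_atTop 0)).exists
    obtain ⟨b, hb, hb2⟩ := intermediate_value_Icc hB0 hc.continuousOn
      (show e / 2 ∈ Icc _ _ from ⟨by rw [R0]; positivity, by linarith⟩)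
    exact ⟨b, hb.1, hb2⟩
  have hcost : ∀ x, 0 < x → |x - T x| ^ p + (Ioc 0 b).indicator (fun _ => 2 ^ (-p) * e) x
      ≤ 2 ^ (-p) := by
    intro x hx
    have hx0 := hx.le
    have h3 : |x - T x| ^ p ≤ 2 ^ (-p) * (2 * |x - T x|) := by
      have h4 : |x - T x| ^ p = 2 ^ (-p) * (2 * |x - T x|) ^ p := by
        rw [Real.mul_rpow (by norm_num) (abs_nonneg _), ← mul_assoc, ← Real.rpow_add (by norm_num)]
        simp
      rw [h4]
      gcongr
      have h5 : 2 * |x - T x| ≤ 1 := by linarith [hd x hx0]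
      calc (2 * |x - T x|) ^ p ≤ (2 * |x - T x|) ^ (1:ℝ) :=
            Real.rpow_le_rpow_of_exponent_ge' (by positivity) h5 (by norm_num) hp.le
        _ = _ := Real.rpow_one _
    by_cases hxb : x ∈ Ioc 0 b
    · rw [indicator_of_mem hxb]
      have h6 : |x - T x| ≤ 1/2 - e / 2 := by
        rcases he0.eq_or_lt with h | h
        · rw [← h]; simpa using hd x hx0
        · apply hde x hx0
          have := hR hxb.2
          linarith
      nlinarith
    · rw [indicator_of_notMem hxb]
      have := hd x hx0
      nlinarith
  refine ⟨μ.map fun x => (x, T x), ?_, ?_, ?_⟩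
  · rw [Measure.map_map measurable_fst (by fun_prop)]
    exact Measure.map_id
  · rw [Measure.map_map measurable_snd (by fun_prop)]
    change μ.map T ≤ _
    have hV0m : Monotone fun x : ℝ => max x 0 - R (max x 0) := fun a b hab =>
      hV (max_le_max hab le_rfl)
    have hV0c : Continuous fun x : ℝ => max x 0 - R (max x 0) := by fun_prop
    let F : StieltjesFunction ℝ := ⟨fun x => max x 0 - R (max x 0), hV0m,
      fun x => hV0c.continuousWithinAt⟩
    have hF : F.measure = (densM volume fun x => 1 - ρ x).restrict (Ioi 0) := by
      refine Measure.ext_of_Ioc _ _ fun a b hab => ?_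
      rw [StieltjesFunction.measure_Ioc, Measure.restrict_apply measurableSet_Ioc, Ioc_inter_Ioi,
        densM, withDensity_apply _ measurableSet_Ioc]
      change ENNReal.ofReal ((max b 0 - R (max b 0)) - (max a 0 - R (max a 0))) = _
      have hab' : max a 0 ≤ max b 0 := max_le_max hab.le le_rfl
      have hset : Ioc (max a 0) b = Ioc (max a 0) (max b 0) := by
        ext x; simp only [mem_Ioc, max_lt_iff, le_max_iff]; grind
      change _ = ∫⁻ x in Ioc (max a 0) b, _
      rw [hVsub, intervalIntegral.integral_of_le hab', hset,
        ofReal_integral_eq_lintegral_ofReal]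
      · exact (integrable_const _).sub hi.integrableOn
      · exact Eventually.of_forall fun x => by have := h1 x; simp only [Pi.zero_apply]; linarith
    rw [← hF]
    apply measure_le_stieltjes
    intro a b hab
    rw [Measure.map_apply hTmeas measurableSet_Ioc, hμ,
      Measure.restrict_apply (hTmeas measurableSet_Ioc)]
    change _ ≤ ENNReal.ofReal ((max b 0 - R (max b 0)) - (max a 0 - R (max a 0)))
    set S := T ⁻¹' Ioc a b ∩ Ioi 0 with hS
    rcases S.eq_empty_or_nonempty with hSe | hSn
    · rw [hSe]; simp
    have hSk : ∀ x ∈ S, max a 0 - R (max a 0) ≤ k x ∧ k x ≤ max b 0 - R (max b 0) := by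
      rintro x ⟨⟨hx1, hx2⟩, hx0 : 0 < x⟩
      rw [← hTk x hx0.le]
      exact ⟨hV (max_le hx1.le (hT0 x hx0.le)), hV (le_max_of_le_left hx2)⟩
    have hSb : BddBelow S := ⟨0, fun x hx => le_of_lt hx.2⟩
    have hSa : BddAbove S := by
      refine ⟨max b 0 - R (max b 0) + 3/4, fun x hx => ?_⟩
      have h3 := hkl x (le_of_lt hx.2)
      have h4 := hR1 (x - 1/4)
      have h5 := (hSk x hx).2
      linarith
    have hdiff : ∀ x ∈ S, ∀ y ∈ S, R y - R x ≤
        (max b 0 - R (max b 0)) - (max a 0 - R (max a 0)) := by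
      intro x hx y hy
      have := (hSk x hx).1
      have := (hSk y hy).2
      rcases le_total x y with h | h
      · have := hkk x y (le_of_lt hx.2) h
        linarith
      · have := hR h
        have := hV0m hab
        simp only at this
        linarith
    have hdiff2 : R (sSup S) - R (sInf S) ≤
        (max b 0 - R (max b 0)) - (max a 0 - R (max a 0)) := by
      have hcl : IsClosed {q : ℝ × ℝ | R q.2 - R q.1 ≤
        (max b 0 - R (max b 0)) - (max a 0 - R (max a 0))} :=
        isClosed_le (by fun_prop) continuous_const
      have hsub : closure (S ×ˢ S) ⊆ {q : ℝ × ℝ | R q.2 - R q.1 ≤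
        (max b 0 - R (max b 0)) - (max a 0 - R (max a 0))} :=
        closure_minimal (fun q hq => hdiff _ hq.1 _ hq.2) hcl
      rw [closure_prod_eq] at hsub
      exact hsub (show (sInf S, sSup S) ∈ _ from
        ⟨csInf_mem_closure hSn hSb, csSup_mem_closure hSn hSa⟩)
    have hI0 : 0 ≤ sInf S := le_csInf hSn fun x hx => le_of_lt hx.2
    have hIS : sInf S ≤ sSup S := csInf_le_csSup hSn hSb hSa
    have hae : densM volume ρ {sInf S} = 0 := by
      have : densM volume ρ ≪ volume := withDensity_absolutelyContinuous _ _
      exact this (by simp)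
    calc densM volume ρ S ≤ densM volume ρ ({sInf S} ∪ Ioc (sInf S) (sSup S)) := by
          refine measure_mono fun x hx => ?_
          have h3 := csInf_le hSb hx
          have h4 := le_csSup hSa hx
          rcases h3.eq_or_lt with h | h
          · left; exact h.symm
          · right; exact ⟨h, h4⟩
      _ ≤ densM volume ρ {sInf S} + densM volume ρ (Ioc (sInf S) (sSup S)) := measure_union_le _ _
      _ = ENNReal.ofReal (R (sSup S) - R (sInf S)) := by rw [hae, zero_add, hμI _ _ hI0 hIS]
      _ ≤ _ := ENNReal.ofReal_le_ofReal hdiff2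
  · have hmeas1 : Measurable fun z : ℝ × ℝ => ENNReal.ofReal (dist z.1 z.2 ^ p) := by fun_prop
    rw [tCost, lintegral_map hmeas1 (by fun_prop)]
    have hgain : ENNReal.ofReal (2 ^ (-p) * e ^ 2 / 2) =
        ∫⁻ x, ENNReal.ofReal ((Ioc 0 b).indicator (fun _ => 2 ^ (-p) * e) x) ∂μ := by
      have : (fun x => ENNReal.ofReal ((Ioc 0 b).indicator (fun _ => 2 ^ (-p) * e) x)) =
          (Ioc 0 b).indicator (fun _ => ENNReal.ofReal (2 ^ (-p) * e)) := by
        ext x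
        by_cases hx : x ∈ Ioc 0 b
        · simp only [indicator_of_mem hx]
        · simp only [indicator_of_notMem hx, ENNReal.ofReal_zero]
      rw [this, lintegral_indicator measurableSet_Ioc, setLIntegral_const, hμ,
        Measure.restrict_apply measurableSet_Ioc, inter_eq_left.2 (fun x hx => hx.1),
        hμI 0 b le_rfl hb0, ← ENNReal.ofReal_mul (by positivity), hb, R0]
      congr 1; ring
    rw [hgain, ← lintegral_add_left (by fun_prop)]
    calc _ ≤ ∫⁻ x, ENNReal.ofReal (2 ^ (-p)) ∂μ := by
          refine lintegral_mono_ae ?_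
          rw [hμ]
          filter_upwards [ae_restrict_mem measurableSet_Ioi] with x hx
          rw [← ENNReal.ofReal_add (by positivity)
            (indicator_nonneg (fun _ _ => by positivity) _), Real.dist_eq]
          exact ENNReal.ofReal_le_ofReal (hcost x hx)
      _ = _ := by
          rw [lintegral_const, hμtot, ← ENNReal.ofReal_mul (by positivity)]
          congr 1; ring

lemma side_map_aux (p : ℝ) (hp : 1 < p) (ρ : ℝ → ℝ) (hm : Measurable ρ) (h0 : ∀ x, 0 ≤ ρ x)
    (h1 : ∀ x, ρ x ≤ 1) (hi : Integrable ρ) (φ : ℝ ≃ᵐ ℝ) (hφ : MeasurePreserving φ volume volume)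
    (hiso : Isometry φ) (S : Set ℝ) (hSm : MeasurableSet S) (hS : φ ⁻¹' S = Ioi 0)
    (hh : ∫ x in S, ρ x = 1 / 2) :
    ∃ π : Measure (ℝ × ℝ), π.map Prod.fst = (densM volume ρ).restrict S ∧
      π.map Prod.snd ≤ (densM volume fun x => 1 - ρ x).restrict S ∧
      tCost p π + ENNReal.ofReal (2 ^ (-p) * (1/2 - ∫ x in (0:ℝ)..1/2, ρ (φ x)) ^ 2 / 2) ≤
        ENNReal.ofReal (2 ^ (-p) / 2) := by
  have hmap : ∀ g : ℝ → ℝ, Measurable g →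
      Measure.map φ ((densM volume fun x => g (φ x)).restrict (Ioi 0)) =
        (densM volume g).restrict S := by
    intro g hg
    ext s hs
    rw [Measure.map_apply φ.measurable hs, Measure.restrict_apply (φ.measurable hs),
      Measure.restrict_apply hs, ← hS, ← preimage_inter, densM, densM,
      withDensity_apply _ (φ.measurable (hs.inter hSm)), withDensity_apply _ (hs.inter hSm)]
    exact hφ.setLIntegral_comp_preimage (hs.inter hSm) (f := fun x => ENNReal.ofReal (g x))
      (by fun_prop)
  obtain ⟨π, hπ1, hπ2, hπ3⟩ := side_aux p hp (fun x => ρ (φ x)) (hm.comp φ.measurable)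
    (fun x => h0 _) (fun x => h1 _)
    (hφ.integrable_comp_of_integrable hi) (by
      rw [← hh, ← hS]
      exact hφ.setIntegral_preimage_emb φ.measurableEmbedding ρ S)
  have hmφ : Measurable (Prod.map φ φ) := φ.measurable.prodMap φ.measurable
  refine ⟨π.map (Prod.map φ φ), ?_, ?_, ?_⟩
  · rw [Measure.map_map measurable_fst hmφ, ← hmap ρ hm, ← hπ1,
      Measure.map_map φ.measurable measurable_fst]
    rfl
  · rw [Measure.map_map measurable_snd hmφ, ← hmap (fun x => 1 - ρ x) (by fun_prop)]
    refine le_trans (le_of_eq ?_) (Measure.map_mono hπ2 φ.measurable)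
    rw [Measure.map_map φ.measurable measurable_snd]
    rfl
  · refine le_trans (le_of_eq ?_) hπ3
    congr 1
    have hmeas1 : Measurable fun z : ℝ × ℝ => ENNReal.ofReal (dist z.1 z.2 ^ p) := by fun_prop
    rw [tCost, lintegral_map hmeas1 hmφ, tCost]
    simp [hiso.dist_eq]

lemma energy_le_aux (p : ℝ) (ρ : ℝ → ℝ) (hm : Measurable ρ) (h0 : ∀ x, 0 ≤ ρ x)
    (h1 : ∀ x, ρ x ≤ 1) (hi : Integrable ρ) (π : Measure (ℝ × ℝ))
    (hπ1 : π.map Prod.fst = densM volume ρ)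
    (hπ2 : π.map Prod.snd ≤ densM volume fun x => 1 - ρ x) :
    WEnergyPow p volume ρ ≤ tCost p π := by
  set ν := π.map Prod.snd with hν
  have htot : ν univ = ∫⁻ x, ENNReal.ofReal (ρ x) := by
    rw [hν, Measure.map_apply measurable_snd MeasurableSet.univ, preimage_univ,
      ← preimage_univ (f := Prod.fst), ← Measure.map_apply measurable_fst MeasurableSet.univ, hπ1,
      densM, withDensity_apply _ MeasurableSet.univ, Measure.restrict_univ]
  have hfin : IsFiniteMeasure ν := ⟨by
    rw [htot, ← ofReal_integral_eq_lintegral_ofReal hi (Eventually.of_forall h0)]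
    exact ENNReal.ofReal_lt_top⟩
  have hac : ν ≪ volume := (Measure.absolutelyContinuous_of_le hπ2).trans
    (withDensity_absolutelyContinuous _ _)
  have hwd : volume.withDensity (ν.rnDeriv volume) = ν := Measure.withDensity_rnDeriv_eq _ _ hac
  have hdens : densM volume (fun x => (ν.rnDeriv volume x).toReal) = ν := by
    conv_rhs => rw [← hwd]
    refine withDensity_congr_ae ?_
    filter_upwards [Measure.rnDeriv_lt_top ν volume] with x hx
    exact ENNReal.ofReal_toReal hx.ne
  have hle : ν.rnDeriv volume ≤ᵐ[volume] fun x => ENNReal.ofReal (1 - ρ x) := by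
    refine ae_le_of_forall_setLIntegral_le_of_sigmaFinite (Measure.measurable_rnDeriv _ _) ?_
    intro s hs _
    rw [← withDensity_apply _ hs, ← withDensity_apply _ hs, hwd]
    exact hπ2 s
  have hadm : Adm volume ρ (fun x => (ν.rnDeriv volume x).toReal) := by
    refine ⟨(Measure.measurable_rnDeriv _ _).ennreal_toReal, fun x => ENNReal.toReal_nonneg, ?_, ?_⟩
    · filter_upwards [hle] with x hx
      have := ENNReal.toReal_mono ENNReal.ofReal_ne_top hx
      rw [ENNReal.toReal_ofReal (by linarith [h1 x])] at this
      linarith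
    · rw [← htot, ← setLIntegral_univ, ← withDensity_apply _ MeasurableSet.univ]
      change densM volume (fun x => (ν.rnDeriv volume x).toReal) univ = _
      rw [hdens]
  refine (iInf₂_le _ hadm).trans ?_
  rw [hdens]
  exact iInf₂_le π ⟨hπ1, rfl⟩

lemma energy_congr_aux (p : ℝ) (ρ σ : ℝ → ℝ) (h : ρ =ᵐ[volume] σ) :
    WEnergyPow p volume ρ = WEnergyPow p volume σ := by
  have h1 : densM volume ρ = densM volume σ := by
    refine withDensity_congr_ae ?_
    filter_upwards [h] with x hx
    rw [hx]
  have h2 : ∀ ρ', Adm volume ρ ρ' ↔ Adm volume σ ρ' := by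
    intro ρ'
    have h3 : ∫⁻ x, ENNReal.ofReal (ρ x) = ∫⁻ x, ENNReal.ofReal (σ x) := by
      refine lintegral_congr_ae ?_
      filter_upwards [h] with x hx
      rw [hx]
    have h4 : (∀ᵐ x, ρ x + ρ' x ≤ 1) ↔ ∀ᵐ x, σ x + ρ' x ≤ 1 := by
      refine eventually_congr ?_
      filter_upwards [h] with x hx
      rw [hx]
    unfold Adm
    rw [h3, h4]
  unfold WEnergyPow
  simp only [h1, h2]

lemma upper_aux (p : ℝ) (hp : 1 < p) (ρ : ℝ → ℝ) (hm : Measurable ρ) (h0 : ∀ x, 0 ≤ ρ x)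
    (h1 : ∀ x, ρ x ≤ 1) (hi : Integrable ρ) (hint : ∫ x, ρ x = 1) :
    WEnergyPow p volume ρ + ENNReal.ofReal (2 ^ (-p) / 16 * asym ρ ^ 2) ≤
      ENNReal.ofReal (2 ^ (-p)) := by
  have hii : ∀ a b, IntervalIntegrable ρ volume a b := fun a b => hi.intervalIntegrable
  have c0 : (0:ℝ) < 2 ^ (-p) := by positivity
  -- median
  obtain ⟨m, hm1⟩ : ∃ m, ∫ x in Iic m, ρ x = 1 / 2 := by
    have hF : ∀ x, ∫ y in Iic x, ρ y = (∫ y in Iic (0:ℝ), ρ y) + ∫ y in (0:ℝ)..x, ρ y := by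
      intro x
      rw [← intervalIntegral.integral_Iic_sub_Iic hi.integrableOn hi.integrableOn]; ring
    have hc : Continuous fun x => ∫ y in Iic x, ρ y := by
      rw [show (fun x => ∫ y in Iic x, ρ y) = _ from funext hF]
      exact continuous_const.add (intervalIntegral.continuous_primitive hii 0)
    have hbot : Tendsto (fun x => ∫ y in Iic x, ρ y) atBot (nhds 0) := by
      have h3 := intervalIntegral_tendsto_integral_Iic (μ := volume) (f := ρ) 0 hi.integrableOn
        tendsto_id
      have h4 : (fun x => ∫ y in Iic x, ρ y) =
          fun x => (∫ y in Iic (0:ℝ), ρ y) - ∫ y in (id x)..(0:ℝ), ρ y := by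
        ext x; rw [hF, id, intervalIntegral.integral_symm]; ring
      rw [h4]
      simpa using (tendsto_const_nhds (x := ∫ y in Iic (0:ℝ), ρ y)).sub h3
    have htop : Tendsto (fun x => ∫ y in Iic x, ρ y) atTop (nhds 1) := by
      have h3 := intervalIntegral_tendsto_integral_Ioi (μ := volume) (f := ρ) 0 hi.integrableOn
        tendsto_id
      have h4 : (1:ℝ) = (∫ y in Iic (0:ℝ), ρ y) + ∫ y in Ioi (0:ℝ), ρ y := by
        rw [← hint, intervalIntegral.integral_Iic_add_Ioi hi.integrableOn hi.integrableOn]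
      rw [h4]
      rw [show (fun x => ∫ y in Iic x, ρ y) = _ from funext hF]
      exact tendsto_const_nhds.add h3
    obtain ⟨a, ha⟩ := (hbot.eventually (gt_mem_nhds (show (0:ℝ) < 1/2 by norm_num))).exists
    obtain ⟨b, hb⟩ := (htop.eventually (lt_mem_nhds (show (1/2:ℝ) < 1 by norm_num))).exists
    exact mem_range_of_exists_le_of_exists_ge hc ⟨a, ha.le⟩ ⟨b, hb.le⟩
  have hm2 : ∫ x in Ioi m, ρ x = 1 / 2 := by
    have := intervalIntegral.integral_Iic_add_Ioi (b := m) (hi.integrableOn (s := Iic m))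
      (hi.integrableOn (s := Ioi m))
    linarith
  have hm1' : ∫ x in Iio m, ρ x = 1 / 2 := by rw [← integral_Iic_eq_integral_Iio]; exact hm1
  obtain ⟨π₁, a1, a2, a3⟩ := side_map_aux p hp ρ hm h0 h1 hi (MeasurableEquiv.addLeft m)
    (measurePreserving_add_left volume m) (isometry_add_left m) (Ioi m) measurableSet_Ioi
    (by ext x; simp) hm2
  obtain ⟨π₂, b1, b2, b3⟩ := side_map_aux p hp ρ hm h0 h1 hi (MeasurableEquiv.subLeft m)
    (Measure.measurePreserving_sub_left volume m) (Isometry.of_dist_eq fun x y => dist_sub_left m x y) (Iio m)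
    measurableSet_Iio (by ext x; change m - x < m ↔ 0 < x; simp) hm1'
  have e1 : ∫ x in (0:ℝ)..1/2, ρ (MeasurableEquiv.addLeft m x) = ∫ x in m..m+1/2, ρ x := by
    have := intervalIntegral.integral_comp_add_left (a := 0) (b := 1/2) ρ m
    rw [add_zero] at this
    exact this
  have e2 : ∫ x in (0:ℝ)..1/2, ρ (MeasurableEquiv.subLeft m x) = ∫ x in (m-1/2)..m, ρ x := by
    have := intervalIntegral.integral_comp_sub_left (a := 0) (b := 1/2) ρ m
    rw [sub_zero] at this
    exact this
  rw [e1] at a3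
  rw [e2] at b3
  set E1 := ∫ x in m..m+1/2, ρ x with hE1
  set E2 := ∫ x in (m-1/2)..m, ρ x with hE2
  have hsum : E2 + E1 = ∫ x in (m-1/2)..(m+1/2), ρ x :=
    intervalIntegral.integral_add_adjacent_intervals (hii _ _) (hii _ _)
  have hasym0 : 0 ≤ asym ρ := Real.iInf_nonneg fun x => integral_nonneg fun y => abs_nonneg _
  have hasym : asym ρ ≤ 2 * (1 - (E2 + E1)) := by
    refine (ciInf_le ⟨0, ?_⟩ m).trans (le_of_eq ?_)
    · rintro _ ⟨x, rfl⟩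
      exact integral_nonneg fun y => abs_nonneg _
    · set I := Ioo (m - 1/2) (m + 1/2) with hI
      have hIm : MeasurableSet I := measurableSet_Ioo
      have hpt : ∀ y, |ρ y - I.indicator (fun _ => (1:ℝ)) y| =
          ρ y + I.indicator (fun y => 1 - 2 * ρ y) y := by
        intro y
        by_cases hy : y ∈ I
        · simp only [indicator_of_mem hy]
          rw [abs_of_nonpos (by linarith [h1 y])]; ring
        · simp only [indicator_of_notMem hy]
          rw [sub_zero, abs_of_nonneg (h0 y), add_zero]
      simp_rw [hpt]
      have hIi : IntegrableOn (fun y => 1 - 2 * ρ y) I :=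
        (integrableOn_const (by simp [hI])).sub (hi.integrableOn.const_mul 2)
      rw [integral_add hi (hIi.integrable_indicator hIm), hint, integral_indicator hIm,
        hI, ← integral_Ioc_eq_integral_Ioo, ← intervalIntegral.integral_of_le (by linarith),
        intervalIntegral.integral_sub (by simp) ((hii _ _).const_mul 2),
        intervalIntegral.integral_const_mul, hsum]
      simp; ring
  have hle : WEnergyPow p volume ρ ≤ tCost p (π₁ + π₂) := by
    refine energy_le_aux p ρ hm h0 h1 hi _ ?_ ?_
    · rw [Measure.map_add _ _ measurable_fst, a1, b1]
      have : (densM volume ρ).restrict (Iio m) = (densM volume ρ).restrict (Iic m) := by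
        refine Measure.restrict_congr_set ?_
        have hac : densM volume ρ ≪ volume := withDensity_absolutelyContinuous _ _
        exact hac.ae_le Iio_ae_eq_Iic
      rw [this, add_comm, ← compl_Iic, Measure.restrict_add_restrict_compl measurableSet_Iic]
    · rw [Measure.map_add _ _ measurable_snd]
      refine (add_le_add a2 b2).trans ?_
      rw [← Measure.restrict_union _ measurableSet_Iio]
      · exact Measure.restrict_le_self
      · exact disjoint_left.2 fun x (hx : m < x) (hx2 : x < m) => lt_asymm hx hx2
  have htc : tCost p (π₁ + π₂) = tCost p π₁ + tCost p π₂ := by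
    simp [tCost, lintegral_add_measure]
  have hfin : ENNReal.ofReal (2 ^ (-p) / 16 * asym ρ ^ 2) ≤
      ENNReal.ofReal (2 ^ (-p) * (1/2 - E1) ^ 2 / 2) +
      ENNReal.ofReal (2 ^ (-p) * (1/2 - E2) ^ 2 / 2) := by
    rw [← ENNReal.ofReal_add (by positivity) (by positivity)]
    apply ENNReal.ofReal_le_ofReal
    have h5 : asym ρ ^ 2 ≤ (2 * (1 - (E2 + E1))) ^ 2 := by gcongr
    have h6 : asym ρ ^ 2 / 16 ≤ ((1/2 - E1) ^ 2 + (1/2 - E2) ^ 2) / 2 := by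
      nlinarith [sq_nonneg (E1 - E2)]
    nlinarith
  calc _ ≤ (tCost p π₁ + tCost p π₂) + (ENNReal.ofReal (2 ^ (-p) * (1/2 - E1) ^ 2 / 2) +
      ENNReal.ofReal (2 ^ (-p) * (1/2 - E2) ^ 2 / 2)) := add_le_add (htc ▸ hle) hfin
    _ = (tCost p π₁ + ENNReal.ofReal (2 ^ (-p) * (1/2 - E1) ^ 2 / 2)) + (tCost p π₂ +
      ENNReal.ofReal (2 ^ (-p) * (1/2 - E2) ^ 2 / 2)) := by ring
    _ ≤ ENNReal.ofReal (2 ^ (-p) / 2) + ENNReal.ofReal (2 ^ (-p) / 2) := add_le_add a3 b3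
    _ = _ := by
      rw [← ENNReal.ofReal_add (by positivity) (by positivity)]
      congr 1; ring

lemma lower_aux (p : ℝ) (hp : 1 < p) (a : ℝ) :
    ENNReal.ofReal (2 ^ (-p)) ≤
      WEnergyPow p volume ((Set.Ioo a (a + 1)).indicator fun _ => (1 : ℝ)) := by
  set χ : ℝ → ℝ := (Set.Ioo a (a + 1)).indicator fun _ => (1 : ℝ) with hχ
  have c0 : (0:ℝ) < 2 ^ (-p) := by positivity
  set c := a + 1 / 2 with hc
  refine le_iInf₂ fun ρ' hρ' => le_iInf₂ fun π hπ => ?_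
  obtain ⟨hm, hn, hle, hmass⟩ := hρ'
  obtain ⟨hπ1, hπ2⟩ := hπ
  have hχm : Measurable χ := measurable_const.indicator measurableSet_Ioo
  have hχe : ∀ x, ENNReal.ofReal (χ x) = (Ioo a (a+1)).indicator (fun _ => (1:ℝ≥0∞)) x := by
    intro x
    by_cases hx : x ∈ Ioo a (a+1)
    · simp only [hχ, indicator_of_mem hx, ENNReal.ofReal_one]
    · simp only [hχ, indicator_of_notMem hx, ENNReal.ofReal_zero]
  have hχ1 : ∫⁻ x, ENNReal.ofReal (χ x) = 1 := by
    simp_rw [hχe]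
    rw [lintegral_indicator measurableSet_Ioo]
    simp
  have hπtot : π univ = 1 := by
    rw [← preimage_univ (f := Prod.fst), ← Measure.map_apply measurable_fst MeasurableSet.univ, hπ1,
      densM, withDensity_apply _ MeasurableSet.univ, Measure.restrict_univ, hχ1]
  -- generic integral of |y - c|
  have hInt : ∀ u v, u ≤ v → ∀ s : ℝ, (∀ y ∈ Ioo u v, |y - c| = s * (y - c)) →
      ∫⁻ y in Ioo u v, ENNReal.ofReal |y - c| =
        ENNReal.ofReal (s * ((v - c) ^ 2 - (u - c) ^ 2) / 2) := by
    intro u v huv s hs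
    rw [← ofReal_integral_eq_lintegral_ofReal
      ((by fun_prop : Continuous fun y => |y - c|).integrableOn_Icc.mono_set Ioo_subset_Icc_self)
      (Eventually.of_forall fun y => abs_nonneg _)]
    rw [setIntegral_congr_fun measurableSet_Ioo hs, ← integral_Ioc_eq_integral_Ioo,
      ← intervalIntegral.integral_of_le huv, intervalIntegral.integral_const_mul,
      intervalIntegral.integral_sub (by simp) (by simp), integral_id]
    congr 1
    simp; ring
  have hsplit : ∀ g : ℝ → ℝ≥0∞, ∀ u v w, u ≤ v → v ≤ w →
      ∫⁻ y in Ioo u w, g y = (∫⁻ y in Ioo u v, g y) + ∫⁻ y in Ioo v w, g y := by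
    intro g u v w huv hvw
    rw [setLIntegral_congr Ioo_ae_eq_Ioc, setLIntegral_congr (Ioo_ae_eq_Ioc (a := u) (b := v)),
      setLIntegral_congr (Ioo_ae_eq_Ioc (a := v) (b := w)), ← Ioc_union_Ioc_eq_Ioc huv hvw,
      lintegral_union measurableSet_Ioc]
    exact Ioc_disjoint_Ioc_of_le le_rfl
  have I1 : ∫⁻ x, ENNReal.ofReal |x - c| ∂(densM volume χ) = ENNReal.ofReal (1/4) := by
    rw [densM, lintegral_withDensity_eq_lintegral_mul _ (by fun_prop) (by fun_prop)]
    have : ∀ x, ((fun x => ENNReal.ofReal (χ x)) * fun x => ENNReal.ofReal |x - c|) x =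
        (Ioo a (a+1)).indicator (fun x => ENNReal.ofReal |x - c|) x := by
      intro x
      rw [Pi.mul_apply, hχe]
      by_cases hx : x ∈ Ioo a (a+1)
      · simp only [indicator_of_mem hx, one_mul]
      · simp only [indicator_of_notMem hx, zero_mul]
    simp_rw [this]
    rw [lintegral_indicator measurableSet_Ioo, hsplit _ a c (a+1) (by linarith) (by linarith),
      hInt a c (by linarith) (-1) (fun y hy => by rw [abs_of_nonpos (by linarith [hy.2])]; ring),
      hInt c (a+1) (by linarith) 1 (fun y hy => by rw [abs_of_nonneg (by linarith [hy.1])]; ring),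
      ← ENNReal.ofReal_add]
    · congr 1; simp only [hc]; ring
    · simp only [hc]; ring_nf; norm_num
    · simp only [hc]; ring_nf; norm_num
  have I2 : ENNReal.ofReal (3/4) ≤ ∫⁻ y, ENNReal.ofReal |y - c| ∂(densM volume ρ') := by
    rw [densM, lintegral_withDensity_eq_lintegral_mul _ (by fun_prop) (by fun_prop)]
    set K := Ioo (a - 1/2) a ∪ Ioo (a + 1) (a + 3/2) with hK
    have hKm : MeasurableSet K := measurableSet_Ioo.union measurableSet_Ioo
    have hdisj : Disjoint (Ioo (a - 1/2) a) (Ioo (a + 1) (a + 3/2)) :=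
      disjoint_left.2 fun x hx hx2 => by linarith [hx.2, hx2.1]
    have hKv : ∫⁻ y, K.indicator (fun _ => (1:ℝ≥0∞)) y = 1 := by
      rw [lintegral_indicator hKm, setLIntegral_one, measure_union hdisj measurableSet_Ioo,
        Real.volume_Ioo, Real.volume_Ioo, ← ENNReal.ofReal_add (by linarith) (by linarith)]
      ring_nf; simp
    have hKi : ∫⁻ y, K.indicator (fun y => ENNReal.ofReal |y - c|) y = ENNReal.ofReal (3/4) := by
      rw [lintegral_indicator hKm, lintegral_union measurableSet_Ioo hdisj,
        hInt (a-1/2) a (by linarith) (-1)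
          (fun y hy => by rw [abs_of_nonpos (by linarith [hy.2])]; ring),
        hInt (a+1) (a+3/2) (by linarith) 1
          (fun y hy => by rw [abs_of_nonneg (by linarith [hy.1])]; ring), ← ENNReal.ofReal_add]
      · congr 1; simp only [hc]; ring
      · simp only [hc]; ring_nf; norm_num
      · simp only [hc]; ring_nf; norm_num
    have hmain : (∫⁻ y, ENNReal.ofReal (ρ' y)) + ∫⁻ y, K.indicator (fun y => ENNReal.ofReal |y - c|) y
        ≤ (∫⁻ y, ((fun x => ENNReal.ofReal (ρ' x)) * fun x => ENNReal.ofReal |x - c|) y) +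
          ∫⁻ y, K.indicator (fun _ => (1:ℝ≥0∞)) y := by
      rw [← lintegral_add_left (by fun_prop), ← lintegral_add_left (by fun_prop)]
      have hna : ∀ᵐ y : ℝ, y ≠ a := by simp [ae_iff]
      have hna1 : ∀ᵐ y : ℝ, y ≠ a + 1 := by simp [ae_iff]
      refine lintegral_mono_ae ?_
      filter_upwards [hle, hna, hna1] with y hy hya hya1
      rw [Pi.mul_apply, ← ENNReal.ofReal_mul (hn y)]
      have hy0 := hn y
      by_cases hyK : y ∈ K
      · simp only [indicator_of_mem hyK]
        rw [← ENNReal.ofReal_one, ← ENNReal.ofReal_add hy0 (abs_nonneg _),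
          ← ENNReal.ofReal_add (by positivity) zero_le_one]
        apply ENNReal.ofReal_le_ofReal
        have hχ0 : 0 ≤ χ y := indicator_nonneg (fun _ _ => zero_le_one) _
        have : |y - c| ≤ 1 := by
          rw [abs_le]
          rcases hyK with h | h <;> constructor <;> linarith [h.1, h.2]
        nlinarith
      · simp only [indicator_of_notMem hyK, add_zero]
        apply ENNReal.ofReal_le_ofReal
        by_cases hyI : y ∈ Ioo a (a+1)
        · have : χ y = 1 := by simp only [hχ, indicator_of_mem hyI]
          have : ρ' y = 0 := by linarith
          simp [this]
        · have : 1 ≤ |y - c| := by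
            rw [le_abs]
            by_contra hcon
            push Not at hcon
            obtain ⟨h1, h2⟩ := hcon
            rcases lt_or_gt_of_ne hya with h | h
            · exact hyK (Or.inl ⟨by linarith, h⟩)
            · rcases lt_or_gt_of_ne hya1 with h' | h'
              · exact hyI ⟨h, h'⟩
              · exact hyK (Or.inr ⟨h', by linarith⟩)
          nlinarith
    rw [hmass, hχ1, hKv, hKi, add_comm] at hmain
    exact (ENNReal.add_le_add_iff_right ENNReal.one_ne_top).1 hmain
  rw [← hπ1, lintegral_map (by fun_prop) measurable_fst] at I1
  rw [← hπ2, lintegral_map (by fun_prop) measurable_snd] at I2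
  have hpt : ∀ z : ℝ × ℝ, ENNReal.ofReal (2 ^ (-p)) +
      ENNReal.ofReal (2 ^ (-p) * p * 2) * ENNReal.ofReal |z.2 - c| ≤
      ENNReal.ofReal (dist z.1 z.2 ^ p) + (ENNReal.ofReal (2 ^ (-p) * p * 2) *
        ENNReal.ofReal |z.1 - c| + ENNReal.ofReal (2 ^ (-p) * p)) := by
    intro z
    rw [← ENNReal.ofReal_mul (by positivity), ← ENNReal.ofReal_mul (by positivity),
      ← ENNReal.ofReal_add (by positivity) (by positivity),
      ← ENNReal.ofReal_add (by positivity) (by positivity),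
      ← ENNReal.ofReal_add (by positivity) (by positivity)]
    apply ENNReal.ofReal_le_ofReal
    have hd : |z.2 - c| ≤ dist z.1 z.2 + |z.1 - c| := by
      have := dist_triangle z.2 z.1 c
      rw [dist_comm z.2 z.1] at this
      simpa [Real.dist_eq] using this
    set d := dist z.1 z.2 with hdd
    have hd0 : 0 ≤ d := dist_nonneg
    have h4 : d ^ p = 2 ^ (-p) * (2 * d) ^ p := by
      rw [Real.mul_rpow (by norm_num) hd0, ← mul_assoc, ← Real.rpow_add (by norm_num)]
      simp
    have hB := one_add_mul_self_le_rpow_one_add (s := 2 * d - 1) (by linarith) hp.le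
    rw [add_sub_cancel] at hB
    rw [h4]
    have h5 := mul_le_mul_of_nonneg_left hB c0.le
    have h6 := mul_le_mul_of_nonneg_left hd (show 0 ≤ 2 ^ (-p) * p * 2 by positivity)
    linarith
  have hI := lintegral_mono (μ := π) hpt
  rw [lintegral_add_left (by fun_prop), lintegral_const_mul _ (by fun_prop),
    lintegral_add_left (by fun_prop), lintegral_add_left (by fun_prop),
    lintegral_const_mul _ (by fun_prop), I1, lintegral_const, lintegral_const, hπtot, mul_one,
    mul_one] at hI
  have hI2 := (add_le_add_right (mul_le_mul_right I2 (ENNReal.ofReal (2 ^ (-p) * p * 2)))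
    (ENNReal.ofReal (2 ^ (-p)))).trans hI
  have hK : ENNReal.ofReal (2 ^ (-p) * p * 2) * ENNReal.ofReal (1/4) + ENNReal.ofReal (2 ^ (-p) * p)
      = ENNReal.ofReal (2 ^ (-p) * p * 2) * ENNReal.ofReal (3/4) := by
    rw [← ENNReal.ofReal_mul (by positivity), ← ENNReal.ofReal_mul (by positivity),
      ← ENNReal.ofReal_add (by positivity) (by positivity)]
    congr 1; ring
  rw [hK] at hI2
  exact (ENNReal.add_le_add_iff_right (by finiteness)).1 hI2

/-- Sharp quantitative inequality in one dimension: there is `C_p > 0` such that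
`𝒲_p(χ_B)^p − 𝒲_p(ρ)^p ≥ C_p·A(ρ)²` for every `ρ ∈ A`, where `B` is any interval of
length `1`. -/
theorem quantitative_inequality_1D (p : ℝ) (hp : 1 < p) :
    ∃ C : ℝ, 0 < C ∧ ∀ a : ℝ, ∀ ρ : ℝ → ℝ, memA volume 1 ρ →
      WEnergyPow p volume ρ + ENNReal.ofReal (C * asym ρ ^ 2) ≤
        WEnergyPow p volume ((Set.Ioo a (a + 1)).indicator fun _ => (1 : ℝ)) := by
  refine ⟨2 ^ (-p) / 16, by positivity, fun a ρ hρ => ?_⟩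
  refine le_trans ?_ (lower_aux p hp a)
  obtain ⟨hm, hb, hint⟩ := hρ
  set σ : ℝ → ℝ := fun x => max 0 (min (ρ x) 1) with hσ
  have hae : ρ =ᵐ[volume] σ := by
    filter_upwards [hb] with x hx
    simp only [hσ, min_eq_left hx.2, max_eq_right hx.1]
  have hi : Integrable ρ := by
    by_contra h
    rw [integral_undef h] at hint
    norm_num at hint
  have hasym : asym ρ = asym σ := by
    unfold asym
    congr 1
    ext x
    refine integral_congr_ae ?_
    filter_upwards [hae] with y hy
    rw [hy]
  rw [energy_congr_aux p ρ σ hae, hasym]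
  refine upper_aux p hp σ (by fun_prop) (fun x => le_max_left _ _)
    (fun x => max_le zero_le_one (min_le_right _ _)) (hi.congr hae) ?_
  rw [← integral_congr_ae hae, hint]
end
end

section
/- Let N=1, p>1, and let B = (−1/2, 1/2). Then 𝒲_p(χ_B)^p = 2^{−p}; equivalently, 𝒲_p(χ_B) = 1/2. -/
open MeasureTheory ENNReal Set Metric Filter

noncomputable section

def TT (x : ℝ) : ℝ := if 0 ≤ x then x + 1/2 else x - 1/2

def AA : Set ℝ := Set.Ioo (-1) (-(1/2)) ∪ Set.Ico (1/2) 1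

lemma TT_meas : Measurable TT :=
  Measurable.ite measurableSet_Ici (by fun_prop) (by fun_prop)

lemma AA_meas : MeasurableSet AA := measurableSet_Ioo.union measurableSet_Ico

lemma TT_abs (x : ℝ) : |TT x| = |x| + 1/2 := by
  unfold TT
  split_ifs with h
  · rw [abs_of_nonneg h, abs_of_nonneg (by linarith)]
  · push Not at h
    rw [abs_of_neg h, abs_of_neg (by linarith)]; ring

lemma TT_dist (x : ℝ) : dist x (TT x) = 1/2 := by
  unfold TT
  rw [Real.dist_eq]
  split_ifs with h
  · rw [abs_of_nonpos (by linarith)]; ring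
  · rw [abs_of_nonneg (by linarith)]; ring

lemma TT_map : (volume.restrict (Set.Ioo (-(1/2) : ℝ) (1/2))).map TT = volume.restrict AA := by
  ext s hs
  rw [Measure.map_apply TT_meas hs, Measure.restrict_apply (TT_meas hs),
    Measure.restrict_apply hs]
  have h1 : TT ⁻¹' s ∩ Set.Ioo (-(1/2) : ℝ) (1/2) =
      ((fun x => x + -(1/2)) ⁻¹' (s ∩ Set.Ioo (-1) (-(1/2)))) ∪
      ((fun x => x + 1/2) ⁻¹' (s ∩ Set.Ico (1/2) 1)) := by
    ext x
    simp only [TT, Set.mem_inter_iff, Set.mem_preimage, Set.mem_union, Set.mem_Ioo, Set.mem_Ico]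
    split_ifs with h
    · constructor
      · rintro ⟨a, b, c⟩
        exact Or.inr ⟨a, by linarith, by linarith⟩
      · rintro (⟨a, b, c⟩ | ⟨a, b, c⟩)
        · linarith
        · exact ⟨a, by linarith, by linarith⟩
    · push Not at h
      rw [sub_eq_add_neg]
      constructor
      · rintro ⟨a, b, c⟩
        exact Or.inl ⟨a, by linarith, by linarith⟩
      · rintro (⟨a, b, c⟩ | ⟨a, b, c⟩)
        · exact ⟨a, by linarith, by linarith⟩
        · linarith
  have m1 : MeasurableSet (s ∩ Set.Ico (1/2 : ℝ) 1) := hs.inter measurableSet_Ico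
  rw [h1, measure_union _ ((measurable_add_const _) m1), measure_preimage_add_right,
    measure_preimage_add_right, AA, Set.inter_union_distrib_left, measure_union _ m1]
  · rw [Set.disjoint_left]
    rintro x ⟨_, _, a⟩ ⟨_, b, _⟩
    linarith
  · rw [Set.disjoint_left]
    rintro x ⟨_, _, a⟩ ⟨_, b, _⟩
    dsimp only at a b
    linarith

lemma dens_ind (S : Set ℝ) (hS : MeasurableSet S) :
    densM volume (S.indicator fun _ => (1 : ℝ)) = volume.restrict S := by
  unfold densM
  have : (fun x => ENNReal.ofReal (S.indicator (fun _ => (1 : ℝ)) x)) =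
      S.indicator 1 := by
    ext x
    by_cases h : x ∈ S <;> simp [h]
  rw [this, withDensity_indicator_one hS]

lemma vol_B : volume (Set.Ioo (-(1/2) : ℝ) (1/2)) = 1 := by
  rw [Real.volume_Ioo]; norm_num

lemma vol_A : volume AA = 1 := by
  have := congrArg (fun m => m Set.univ) TT_map
  simp only [Measure.map_apply TT_meas MeasurableSet.univ, Set.preimage_univ,
    Measure.restrict_apply_univ, vol_B] at this
  exact this.symm

lemma lint_ind (S : Set ℝ) (hS : MeasurableSet S) :
    ∫⁻ x, ENNReal.ofReal (S.indicator (fun _ => (1 : ℝ)) x) = volume S := by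
  have := congrArg (fun m => m Set.univ) (dens_ind S hS)
  simpa [densM] using this

lemma upper (p : ℝ) :
    WEnergyPow p volume ((Set.Ioo (-(1/2) : ℝ) (1/2)).indicator fun _ => (1 : ℝ)) ≤
      ENNReal.ofReal ((2 : ℝ) ^ (-p)) := by
  unfold WEnergyPow
  refine iInf₂_le_of_le (AA.indicator fun _ => (1 : ℝ)) ⟨?_, ?_, ?_, ?_⟩ ?_
  · exact measurable_const.indicator AA_meas
  · intro x; exact Set.indicator_nonneg (by simp) x
  · refine Filter.Eventually.of_forall fun x => ?_
    by_cases h : x ∈ Set.Ioo (-(1/2) : ℝ) (1/2)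
    · have : x ∉ AA := by
        rintro (⟨a, b⟩ | ⟨a, b⟩) <;> linarith [h.1, h.2]
      simp only [Set.indicator_of_mem h, Set.indicator_of_notMem this]; norm_num
    · simp only [Set.indicator_of_notMem h, zero_add]
      exact Set.indicator_le_self' (by simp) x
  · rw [lint_ind _ AA_meas, lint_ind _ measurableSet_Ioo, vol_A, vol_B]
  · rw [dens_ind _ AA_meas, dens_ind _ measurableSet_Ioo]
    unfold WpPow
    have hm : Measurable fun x : ℝ => (x, TT x) := measurable_id.prodMk TT_meas
    refine iInf₂_le_of_le ((volume.restrict (Set.Ioo (-(1/2) : ℝ) (1/2))).map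
      fun x => (x, TT x)) ⟨?_, ?_⟩ ?_
    · rw [Measure.map_map measurable_fst hm]
      exact Measure.map_id
    · rw [Measure.map_map measurable_snd hm]
      exact TT_map
    · unfold tCost
      rw [lintegral_map (by fun_prop) hm]
      simp only [TT_dist, lintegral_const, Measure.restrict_apply_univ, vol_B, mul_one]
      rw [one_div, Real.inv_rpow (by norm_num), Real.rpow_neg (by norm_num)]

lemma bathtub (ρ' : ℝ → ℝ)
    (h : Adm volume ((Set.Ioo (-(1/2) : ℝ) (1/2)).indicator fun _ => (1 : ℝ)) ρ') :
    ∫⁻ y in AA, ENNReal.ofReal |y| ≤ ∫⁻ y, ENNReal.ofReal |y| ∂(densM volume ρ') := by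
  obtain ⟨hm, h0, h1, h2⟩ := h
  rw [lint_ind _ measurableSet_Ioo, vol_B] at h2
  unfold densM
  rw [lintegral_withDensity_eq_lintegral_mul _ (by fun_prop) (by fun_prop)]
  rw [← lintegral_indicator AA_meas]
  have key : ∫⁻ y, (AA.indicator (fun y => ENNReal.ofReal |y|) y + ENNReal.ofReal (ρ' y)) ≤
      ∫⁻ y, (ENNReal.ofReal (ρ' y) * ENNReal.ofReal |y| +
        ENNReal.ofReal (AA.indicator (fun _ => (1 : ℝ)) y)) := by
    apply lintegral_mono_ae
    have hne : ∀ᵐ y : ℝ, y ≠ -(1/2) := by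
      simp [ae_iff]
    filter_upwards [h1, hne] with y hy hyn
    have hy0 := h0 y
    have ha := abs_nonneg y
    by_cases hA : y ∈ AA
    · have hl : |y| ≤ 1 := by
        rcases hA with ⟨a, b⟩ | ⟨a, b⟩ <;> rw [abs_le] <;> constructor <;> linarith
      have hr : ρ' y ≤ 1 := by
        have : 0 ≤ (Set.Ioo (-(1/2) : ℝ) (1/2)).indicator (fun _ => (1 : ℝ)) y :=
          Set.indicator_nonneg (by simp) y
        linarith
      rw [Set.indicator_of_mem hA, Set.indicator_of_mem hA, ← ENNReal.ofReal_mul hy0,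
        ← ENNReal.ofReal_add ha hy0, ← ENNReal.ofReal_add (by positivity) (by norm_num)]
      apply ENNReal.ofReal_le_ofReal
      nlinarith
    · rw [Set.indicator_of_notMem hA, Set.indicator_of_notMem hA, ← ENNReal.ofReal_mul hy0,
        zero_add, ENNReal.ofReal_zero, add_zero]
      apply ENNReal.ofReal_le_ofReal
      by_cases hB : y ∈ Set.Ioo (-(1/2) : ℝ) (1/2)
      · rw [Set.indicator_of_mem hB] at hy
        have : ρ' y = 0 := by linarith
        simp [this]
      · have : 1 ≤ |y| := by
          by_contra hc
          push Not at hc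
          rw [abs_lt] at hc
          rcases lt_or_ge y (-(1/2)) with h3 | h3
          · exact hA (Or.inl ⟨hc.1, h3⟩)
          · rcases lt_or_ge y (1/2) with h4 | h4
            · exact hB ⟨lt_of_le_of_ne h3 (Ne.symm hyn), h4⟩
            · exact hA (Or.inr ⟨h4, hc.2⟩)
        nlinarith
  rw [lintegral_add_right _ (by fun_prop), lintegral_add_left (by fun_prop), h2,
    lint_ind _ AA_meas, vol_A] at key
  exact (ENNReal.add_le_add_iff_right ENNReal.one_ne_top).1 key

lemma lower (p : ℝ) (hp : 1 < p) (ρ' : ℝ → ℝ)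
    (h : Adm volume ((Set.Ioo (-(1/2) : ℝ) (1/2)).indicator fun _ => (1 : ℝ)) ρ')
    (π : Measure (ℝ × ℝ)) (hπ : IsCoupling π (densM volume
      ((Set.Ioo (-(1/2) : ℝ) (1/2)).indicator fun _ => (1 : ℝ))) (densM volume ρ')) :
    ENNReal.ofReal ((2 : ℝ) ^ (-p)) ≤ tCost p π := by
  have hb := bathtub ρ' h
  obtain ⟨e1, e2⟩ := hπ
  rw [dens_ind _ measurableSet_Ioo] at e1
  have hprob : IsProbabilityMeasure π := by
    constructor
    have := congrArg (fun m => m Set.univ) e1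
    simpa only [Measure.map_apply measurable_fst MeasurableSet.univ, Set.preimage_univ,
      Measure.restrict_apply_univ, vol_B] using this
  rw [← TT_map, lintegral_map (by fun_prop) TT_meas, ← e2,
    lintegral_map (by fun_prop) measurable_snd] at hb
  simp only [TT_abs] at hb
  have hs : ∀ x : ℝ, ENNReal.ofReal (|x| + 1/2) = ENNReal.ofReal |x| + ENNReal.ofReal (1/2) :=
    fun x => ENNReal.ofReal_add (abs_nonneg x) (by norm_num)
  simp only [hs] at hb
  rw [lintegral_add_right _ (by fun_prop), lintegral_const, Measure.restrict_apply_univ, vol_B,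
    mul_one] at hb
  have hM : ∫⁻ x in Set.Ioo (-(1/2) : ℝ) (1/2), ENNReal.ofReal |x| ≠ ∞ := by
    have : ∫⁻ x in Set.Ioo (-(1/2) : ℝ) (1/2), ENNReal.ofReal |x| ≤
        ∫⁻ x in Set.Ioo (-(1/2) : ℝ) (1/2), 1 := by
      apply setLIntegral_mono measurable_const
      rintro x ⟨a, b⟩
      rw [ENNReal.ofReal_le_one, abs_le]
      constructor <;> linarith
    refine ne_top_of_le_ne_top ?_ this
    rw [lintegral_const, Measure.restrict_apply_univ, vol_B]
    simp
  have htri : ∫⁻ z, ENNReal.ofReal |z.2| ∂π ≤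
      (∫⁻ x in Set.Ioo (-(1/2) : ℝ) (1/2), ENNReal.ofReal |x|) +
        ∫⁻ z, ENNReal.ofReal (dist z.1 z.2) ∂π := by
    rw [← e1, lintegral_map (by fun_prop) measurable_fst, ← lintegral_add_left (by fun_prop)]
    apply lintegral_mono
    intro z
    dsimp only
    rw [← ENNReal.ofReal_add (abs_nonneg _) dist_nonneg]
    apply ENNReal.ofReal_le_ofReal
    rw [Real.dist_eq, abs_sub_comm]
    have := abs_add_le z.1 (z.2 - z.1)
    simpa using this
  have hhalf : ENNReal.ofReal (1/2) ≤ ∫⁻ z, ENNReal.ofReal (dist z.1 z.2) ∂π :=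
    (ENNReal.add_le_add_iff_left hM).1 (hb.trans htri)
  have hq := (Real.HolderConjugate.conjExponent hp)
  have hJ := ENNReal.lintegral_mul_le_Lp_mul_Lq π hq
    (f := fun z => ENNReal.ofReal (dist z.1 z.2)) (g := fun _ => 1) (by fun_prop) (by fun_prop)
  simp only [Pi.mul_apply, mul_one, ENNReal.one_rpow, lintegral_const, measure_univ] at hJ
  have h3 := ENNReal.rpow_le_rpow (hhalf.trans hJ) (by linarith : 0 ≤ p)
  rw [← ENNReal.rpow_mul, one_div_mul_cancel (by linarith), ENNReal.rpow_one,
    ENNReal.ofReal_rpow_of_pos (by norm_num), one_div, Real.inv_rpow (by norm_num),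
    ← Real.rpow_neg (by norm_num)] at h3
  refine h3.trans (le_of_eq ?_)
  unfold tCost
  congr 1
  ext z
  rw [ENNReal.ofReal_rpow_of_nonneg dist_nonneg (by linarith)]

/-- The energy of the unit interval `B = (-1/2, 1/2)` in dimension one:
`𝒲_p(χ_B)^p = 2^{-p}`. -/
theorem energy_of_interval (p : ℝ) (hp : 1 < p) :
    WEnergyPow p volume ((Set.Ioo (-(1/2) : ℝ) (1/2)).indicator fun _ => (1 : ℝ)) =
      ENNReal.ofReal ((2 : ℝ) ^ (-p)) := by
  refine le_antisymm (upper p) ?_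
  exact le_iInf₂ fun ρ' h => le_iInf₂ fun π hπ => lower p hp ρ' h π hπ
end
end

section
/- Let N=1 and p>1. There exists ε₀ > 0 such that for every ε ∈ (0, ε₀), the density ρ_ε = χ_{[−1/2−ε, −1/2]} + χ_{[−1/2+ε, 1/2−ε]} + χ_{[1/2, 1/2+ε]} belongs to A and satisfies 𝒲_p(ρ_ε)^p = 2^{−p} − 4ε·(2^{−p} − (1/2 − ε)^p). -/
open MeasureTheory ENNReal Set Metric Filter

noncomputable section

set_option linter.unusedSectionVars false
set_option linter.unusedVariables false
namespace PertInt

/-- tangent line inequality -/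
lemma tangent (p s u : ℝ) (hp : 1 < p) (hs : 0 < s) (hu : 0 ≤ u) :
    s ^ p + p * s ^ (p - 1) * (u - s) ≤ u ^ p := by
  have h1 : -1 ≤ u / s - 1 := by
    have : 0 ≤ u / s := by positivity
    linarith
  have h2 := one_add_mul_self_le_rpow_one_add h1 hp.le
  have h3 : 1 + (u / s - 1) = u / s := by ring
  rw [h3, Real.div_rpow hu hs.le] at h2
  have hsp : 0 < s ^ p := Real.rpow_pos_of_pos hs p
  rw [le_div_iff₀ hsp] at h2
  have h4 : s ^ p = s ^ (p - 1) * s := by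
    rw [← Real.rpow_add_one hs.ne']; ring_nf
  have h5 : (1 + p * (u / s - 1)) * s ^ p = s ^ p + p * s ^ (p - 1) * (u - s) := by
    rw [h4]; field_simp
  linarith

def phi0 (ε a b K k t : ℝ) : ℝ :=
  if t ≤ 1/2 - ε then
    min (a * ε + K + b * (1/2 - ε - t)) (a * ε + K + b * (1/2 - 2 * ε) + a * (ε - t))
  else k + a * (1/2 + ε - t)

def psi0 (ε a b K k t : ℝ) : ℝ :=
  if t ≤ 1/2 then a * ε + K + b * (1/2 - 2 * ε) - k + a * (1/2 - t)
  else max 0 (max (a * (1 - t)) (a * ε + b * (1 - ε - t)))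

lemma phi0_meas (ε a b K k : ℝ) : Measurable (phi0 ε a b K k) := by
  unfold phi0
  refine Measurable.ite measurableSet_Iic ?_ ?_ <;> fun_prop

lemma psi0_meas (ε a b K k : ℝ) : Measurable (psi0 ε a b K k) := by
  unfold psi0
  refine Measurable.ite measurableSet_Iic ?_ ?_ <;> fun_prop

section
variable {ε a b K k : ℝ} (h0 : 0 < ε) (h4 : ε < 1/4) (ha : 0 ≤ a) (hab : a ≤ b) (hkK : k ≤ K)
  (hk : 0 ≤ k)
include h0 h4 ha hab hkK hk

lemma psi0_nonneg {t : ℝ} : 0 ≤ psi0 ε a b K k t := by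
  unfold psi0
  split_ifs with h
  · have := mul_nonneg ha h0.le
    have := mul_nonneg ha (show 0 ≤ 1/2 - t by linarith)
    have := mul_nonneg (ha.trans hab) (show 0 ≤ 1/2 - 2 * ε by linarith)
    linarith
  · exact le_max_left _ _

lemma psi0_zero {t : ℝ} (ht : 1 ≤ t) : psi0 ε a b K k t = 0 := by
  unfold psi0
  rw [if_neg (by linarith)]
  apply max_eq_left
  apply max_le
  · nlinarith
  · nlinarith

lemma psi0_le {t : ℝ} (ht : 0 ≤ t) : psi0 ε a b K k t ≤ a + K + 2 * b := by
  unfold psi0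
  split_ifs with h
  · nlinarith
  · refine max_le (by nlinarith) (max_le (by nlinarith) (by nlinarith))

lemma eqA {t : ℝ} (h : 0 ≤ t) (h' : t ≤ ε) :
    phi0 ε a b K k t = psi0 ε a b K k (t + (1/2 - ε)) + k := by
  unfold phi0 psi0
  rw [if_pos (by linarith), if_pos (by linarith), min_eq_right]
  · ring
  · nlinarith [mul_nonneg (sub_nonneg.2 hab) (sub_nonneg.2 h')]

lemma eqB {t : ℝ} (h : ε ≤ t) (h' : t ≤ 1/2 - ε) :
    phi0 ε a b K k t = psi0 ε a b K k (t + 1/2) + K := by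
  unfold phi0 psi0
  rw [if_pos (by linarith), if_neg (by linarith), min_eq_left, max_eq_right, max_eq_right]
  · ring
  · nlinarith [mul_nonneg (sub_nonneg.2 hab) (sub_nonneg.2 h')]
  · refine le_max_of_le_right ?_
    nlinarith [mul_nonneg (ha.trans hab) (sub_nonneg.2 h')]
  · nlinarith [mul_nonneg (sub_nonneg.2 hab) (sub_nonneg.2 h)]

lemma eqC {t : ℝ} (h : 1/2 ≤ t) (h' : t ≤ 1/2 + ε) :
    phi0 ε a b K k t = psi0 ε a b K k (t + (1/2 - ε)) + k := by
  unfold phi0 psi0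
  rw [if_neg (by linarith), if_neg (by linarith), max_eq_right, max_eq_left]
  · ring
  · nlinarith [mul_nonneg (sub_nonneg.2 hab) (sub_nonneg.2 h)]
  · refine le_max_of_le_left ?_
    nlinarith [mul_nonneg ha (sub_nonneg.2 h')]

lemma key (c : ℝ → ℝ) (hc0 : ∀ u, 0 ≤ c u) (hcK : ∀ u, K + b * (u - 1/2) ≤ c u)
    (hck : ∀ u, k + a * (u - (1/2 - ε)) ≤ c u) (hbad : 2 * k - K ≤ b * (1/2 - 2 * ε))
    {t r : ℝ} (ht : t ≤ 1/2 - ε ∨ (1/2 ≤ t ∧ t ≤ 1/2 + ε))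
    (hr : (1/2 - ε ≤ r ∧ r ≤ 1/2) ∨ 1/2 + ε ≤ r) :
    phi0 ε a b K k t ≤ c (r - t) + psi0 ε a b K k r := by
  have e1 := hcK (r - t)
  have e2 := hck (r - t)
  have e3 := hc0 (r - t)
  rcases ht with ht | ht <;> rcases hr with hr | hr
  · unfold phi0 psi0
    rw [if_pos ht, if_pos hr.2]
    refine (min_le_right _ _).trans ?_
    linarith
  · unfold phi0 psi0
    rw [if_pos ht, if_neg (by linarith)]
    refine (min_le_left _ _).trans ?_
    have : a * ε + b * (1 - ε - r) ≤ max 0 (max (a * (1 - r)) (a * ε + b * (1 - ε - r))) :=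
      le_max_of_le_right (le_max_right _ _)
    linarith
  · unfold phi0 psi0
    rw [if_neg (by linarith), if_pos hr.2]
    have := mul_nonneg ha (sub_nonneg.2 ht.1)
    have := mul_nonneg ha (sub_nonneg.2 hr.2)
    linarith
  · unfold phi0 psi0
    rw [if_neg (by linarith), if_neg (by linarith)]
    have : a * (1 - r) ≤ max 0 (max (a * (1 - r)) (a * ε + b * (1 - ε - r))) :=
      le_max_of_le_right (le_max_left _ _)
    linarith

end

/-- piece of the optimal plan -/
def pl (u v s : ℝ) : Measure (ℝ × ℝ) := (volume.restrict (Ioc u v)).map (fun x => (x, x + s))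

lemma pl_fst (u v s : ℝ) : (pl u v s).map Prod.fst = volume.restrict (Ioc u v) := by
  unfold pl
  rw [Measure.map_map measurable_fst (by fun_prop)]
  exact Measure.map_id

lemma pl_snd (u v s : ℝ) : (pl u v s).map Prod.snd = volume.restrict (Ioc (u + s) (v + s)) := by
  unfold pl
  rw [Measure.map_map measurable_snd (by fun_prop)]
  have h : (fun x : ℝ => x + s) ⁻¹' (Ioc (u + s) (v + s)) = Ioc u v := by
    ext x; simp
  have := ((measurePreserving_add_right (volume : Measure ℝ) s).restrict_preimage
    (measurableSet_Ioc (a := u + s) (b := v + s))).map_eq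
  rw [h] at this
  exact this

lemma pl_cost (p u v s : ℝ) : tCost p (pl u v s) = ENNReal.ofReal (|s| ^ p) * ENNReal.ofReal (v - u) := by
  unfold tCost pl
  rw [lintegral_map (by fun_prop) (by fun_prop)]
  simp

lemma pl_int (u v s k : ℝ) (hk : 0 ≤ k) (f g : ℝ → ℝ) (hg : Measurable g) (hg0 : ∀ x, 0 ≤ g x)
    (h : ∀ x ∈ Ioc u v, f x = g (x + s) + k) :
    ∫⁻ x in Ioc u v, ENNReal.ofReal (f x) =
      (∫⁻ x in Ioc (u + s) (v + s), ENNReal.ofReal (g x)) + ENNReal.ofReal k * ENNReal.ofReal (v - u) := by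
  rw [← pl_snd, lintegral_map (by fun_prop) measurable_snd]
  unfold pl
  rw [lintegral_map (by fun_prop) (by fun_prop)]
  rw [setLIntegral_congr_fun (g := fun x => ENNReal.ofReal (g (x + s)) + ENNReal.ofReal k)
    measurableSet_Ioc]
  · rw [lintegral_add_right _ measurable_const]; simp
  · intro x hx
    simp only
    rw [h x hx, ENNReal.ofReal_add (hg0 _) hk]

lemma restrict_split {u v w : ℝ} (h : u ≤ v) (h' : v ≤ w) :
    (volume : Measure ℝ).restrict (Ioc u w) = volume.restrict (Ioc u v) + volume.restrict (Ioc v w) := by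
  rw [← Ioc_union_Ioc_eq_Ioc h h', Measure.restrict_union _ measurableSet_Ioc]
  exact Ioc_disjoint_Ioc_of_le le_rfl

lemma dens_add (f g : ℝ → ℝ) (hf : Measurable f) (hf0 : ∀ x, 0 ≤ f x) (hg0 : ∀ x, 0 ≤ g x) :
    densM volume (fun x => f x + g x) = densM volume f + densM volume g := by
  unfold densM
  rw [← withDensity_add_left (by fun_prop)]
  congr 1
  funext x
  simp [ENNReal.ofReal_add (hf0 x) (hg0 x)]

lemma dens_ind (s : Set ℝ) (hs : MeasurableSet s) :
    densM volume (s.indicator (fun _ => (1:ℝ))) = volume.restrict s := by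
  unfold densM
  rw [← withDensity_indicator_one hs]
  congr 1
  funext x
  by_cases h : x ∈ s <;> simp [h]

lemma ind_nonneg (s : Set ℝ) (x : ℝ) : 0 ≤ s.indicator (fun _ => (1:ℝ)) x :=
  indicator_nonneg (fun _ _ => zero_le_one) x

def rho (ε : ℝ) : ℝ → ℝ := fun x : ℝ =>
          (Set.Icc (-(1/2) - ε) (-(1/2))).indicator (fun _ => (1 : ℝ)) x +
          (Set.Icc (-(1/2) + ε) (1/2 - ε)).indicator (fun _ => (1 : ℝ)) x +
          (Set.Icc (1/2 : ℝ) (1/2 + ε)).indicator (fun _ => (1 : ℝ)) x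

def rho' (ε : ℝ) : ℝ → ℝ := fun x : ℝ =>
          (Set.Ioo (-1) (-(1/2) - ε)).indicator (fun _ => (1 : ℝ)) x +
          (Set.Ioo (-(1/2)) (-(1/2) + ε)).indicator (fun _ => (1 : ℝ)) x +
          (Set.Ioo (1/2 - ε) (1/2)).indicator (fun _ => (1 : ℝ)) x +
          (Set.Ioo (1/2 + ε) 1).indicator (fun _ => (1 : ℝ)) x

lemma rho_meas (ε : ℝ) : Measurable (rho ε) := by
  unfold rho
  refine Measurable.add (Measurable.add ?_ ?_) ?_ <;>
  exact measurable_const.indicator measurableSet_Icc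

lemma rho'_meas (ε : ℝ) : Measurable (rho' ε) := by
  unfold rho'
  refine Measurable.add (Measurable.add (Measurable.add ?_ ?_) ?_) ?_ <;>
  exact measurable_const.indicator measurableSet_Ioo

lemma rho'_nonneg (ε x : ℝ) : 0 ≤ rho' ε x := by
  unfold rho'
  have := ind_nonneg
  exact add_nonneg (add_nonneg (add_nonneg (this _ _) (this _ _)) (this _ _)) (this _ _)

lemma rho_nonneg (ε x : ℝ) : 0 ≤ rho ε x := by
  unfold rho
  have := ind_nonneg
  exact (add_nonneg (add_nonneg (this _ _) (this _ _)) (this _ _))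

lemma rho_one {ε x : ℝ} (h0 : 0 < ε) (h4 : ε < 1/4)
    (h : |x| ≤ 1/2 - ε ∨ (1/2 ≤ |x| ∧ |x| ≤ 1/2 + ε)) : rho ε x = 1 := by
  unfold rho
  simp only [indicator, mem_Icc]
  rcases abs_cases x with hx | hx <;> rw [hx.1] at h <;> rcases h with h | h
  · rw [if_neg (by intro h; linarith), if_pos (by constructor <;> linarith), if_neg (by intro h; linarith)]; simp
  · rw [if_neg (by intro h; linarith), if_neg (by intro h; linarith), if_pos (by constructor <;> linarith)]; simp
  · rw [if_neg (by intro h; linarith), if_pos (by constructor <;> linarith), if_neg (by intro h; linarith)]; simp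
  · rw [if_pos (by constructor <;> linarith), if_neg (by intro h; linarith), if_neg (by intro h; linarith)]; simp

lemma rho_zero {ε x : ℝ} (h0 : 0 < ε) (h4 : ε < 1/4)
    (h : ¬ (|x| ≤ 1/2 - ε ∨ (1/2 ≤ |x| ∧ |x| ≤ 1/2 + ε))) : rho ε x = 0 := by
  unfold rho
  simp only [indicator, mem_Icc]
  rw [if_neg, if_neg, if_neg]
  · simp
  all_goals
    intro h'
    apply h
    rcases abs_cases x with hx | hx <;> rw [hx.1]
    all_goals first
      | (left; linarith)
      | (right; constructor <;> linarith)

lemma rho'_zero {ε x : ℝ} (h0 : 0 < ε) (h4 : ε < 1/4)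
    (h : |x| ≤ 1/2 - ε ∨ (1/2 ≤ |x| ∧ |x| ≤ 1/2 + ε)) : rho' ε x = 0 := by
  unfold rho'
  simp only [indicator, mem_Ioo]
  rw [if_neg, if_neg, if_neg, if_neg]
  · simp
  all_goals
    intro h'
    rcases abs_cases x with hx | hx <;> rw [hx.1] at h <;> rcases h with h | h <;> linarith

lemma rho'_one {ε x : ℝ} (h0 : 0 < ε) (h4 : ε < 1/4)
    (h : (1/2 - ε < |x| ∧ |x| < 1/2) ∨ (1/2 + ε < |x| ∧ |x| < 1)) : rho' ε x = 1 := by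
  unfold rho'
  simp only [indicator, mem_Ioo]
  rcases abs_cases x with hx | hx <;> rw [hx.1] at h <;> rcases h with h | h
  · rw [if_neg (by intro h; linarith), if_neg (by intro h; linarith), if_pos (by constructor <;> linarith), if_neg (by intro h; linarith)]; simp
  · rw [if_neg (by intro h; linarith), if_neg (by intro h; linarith), if_neg (by intro h; linarith), if_pos (by constructor <;> linarith)]; simp
  · rw [if_neg (by intro h; linarith), if_pos (by constructor <;> linarith), if_neg (by intro h; linarith), if_neg (by intro h; linarith)]; simp
  · rw [if_pos (by constructor <;> linarith), if_neg (by intro h; linarith), if_neg (by intro h; linarith), if_neg (by intro h; linarith)]; simp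

lemma rho'_le {ε x : ℝ} (h0 : 0 < ε) (h4 : ε < 1/4) : rho' ε x ≤ 1 := by
  unfold rho'
  simp only [indicator, mem_Ioo]
  split_ifs <;> linarith

lemma madd (f g : ℝ → ℝ) (hf : Measurable f) (hg : Measurable g) :
    Measurable (fun x => f x + g x) := hf.add hg

lemma dens_rho {ε : ℝ} (h0 : 0 < ε) (h4 : ε < 1/4) :
    densM volume (rho ε) = volume.restrict (Ioc (-(1/2) - ε) (-(1/2)))
      + (volume.restrict (Ioc (-(1/2) + ε) (-ε)) + volume.restrict (Ioc (-ε) 0)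
      + volume.restrict (Ioc 0 ε) + volume.restrict (Ioc ε (1/2 - ε)))
      + volume.restrict (Ioc (1/2) (1/2 + ε)) := by
  have hm : ∀ a b : ℝ, Measurable ((Icc a b).indicator (fun _ => (1:ℝ))) :=
    fun a b => measurable_const.indicator measurableSet_Icc
  unfold rho
  rw [dens_add _ _ (madd _ _ (hm _ _) (hm _ _)) (fun x => add_nonneg (ind_nonneg _ _) (ind_nonneg _ _))
    (ind_nonneg _), dens_add _ _ (hm _ _) (ind_nonneg _) (ind_nonneg _)]
  simp only [dens_ind _ measurableSet_Icc]
  simp only [← Measure.restrict_congr_set (Ioc_ae_eq_Icc (μ := (volume : Measure ℝ)))]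
  rw [← restrict_split, ← restrict_split, ← restrict_split]
  all_goals linarith

lemma dens_rho' {ε : ℝ} (h0 : 0 < ε) (h4 : ε < 1/4) :
    densM volume (rho' ε) = volume.restrict (Ioc (-1) (-1 + ε)) + volume.restrict (Ioc (-1 + ε) (-(1/2) - ε))
      + volume.restrict (Ioc (-(1/2)) (-(1/2) + ε)) + volume.restrict (Ioc (1/2 - ε) (1/2))
      + (volume.restrict (Ioc (1/2 + ε) (1 - ε)) + volume.restrict (Ioc (1 - ε) 1)) := by
  have hm : ∀ a b : ℝ, Measurable ((Ioo a b).indicator (fun _ => (1:ℝ))) :=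
    fun a b => measurable_const.indicator measurableSet_Ioo
  have hn := ind_nonneg
  unfold rho'
  rw [dens_add _ _ (madd _ _ (madd _ _ (hm _ _) (hm _ _)) (hm _ _))
    (fun x => add_nonneg (add_nonneg (hn _ _) (hn _ _)) (hn _ _)) (hn _),
    dens_add _ _ (madd _ _ (hm _ _) (hm _ _)) (fun x => add_nonneg (hn _ _) (hn _ _))
    (hn _), dens_add _ _ (hm _ _) (hn _) (hn _)]
  simp only [dens_ind _ measurableSet_Ioo]
  simp only [Measure.restrict_congr_set (Ioo_ae_eq_Ioc (μ := (volume : Measure ℝ)))]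
  rw [← restrict_split, ← restrict_split]
  all_goals linarith


lemma lint_rho {ε : ℝ} (h0 : 0 < ε) (h4 : ε < 1/4) : ∫⁻ x, ENNReal.ofReal (rho ε x) = 1 := by
  have : ∫⁻ x, ENNReal.ofReal (rho ε x) = densM volume (rho ε) univ := by simp [densM]
  rw [this, dens_rho h0 h4]
  simp only [Measure.add_apply, Measure.restrict_apply_univ, Real.volume_Ioc]
  repeat rw [← ENNReal.ofReal_add (by linarith) (by linarith)]
  rw [← ENNReal.ofReal_one]
  congr 1
  ring

lemma memA_rho {ε : ℝ} (h0 : 0 < ε) (h4 : ε < 1/4) : memA volume 1 (rho ε) := by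
  refine ⟨rho_meas ε, ?_, ?_⟩
  · refine Eventually.of_forall fun x => ⟨rho_nonneg ε x, ?_⟩
    by_cases h : |x| ≤ 1/2 - ε ∨ (1/2 ≤ |x| ∧ |x| ≤ 1/2 + ε)
    · exact (rho_one h0 h4 h).le
    · rw [rho_zero h0 h4 h]; exact zero_le_one
  · rw [integral_eq_lintegral_of_nonneg_ae (Eventually.of_forall (rho_nonneg ε))
      (rho_meas ε).aestronglyMeasurable, lint_rho h0 h4]
    simp

def plan (ε : ℝ) : Measure (ℝ × ℝ) :=
  pl (-(1/2) - ε) (-(1/2)) (-(1/2 - ε))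
      + (pl (-(1/2) + ε) (-ε) (-(1/2)) + pl (-ε) 0 (-(1/2 - ε))
      + pl 0 ε (1/2 - ε) + pl ε (1/2 - ε) (1/2))
      + pl (1/2) (1/2 + ε) (1/2 - ε)

lemma plan_coupling {ε : ℝ} (h0 : 0 < ε) (h4 : ε < 1/4) :
    IsCoupling (plan ε) (densM volume (rho ε)) (densM volume (rho' ε)) := by
  constructor
  · rw [dens_rho h0 h4]
    unfold plan
    simp only [Measure.map_add _ _ measurable_fst, pl_fst]
  · rw [dens_rho' h0 h4]
    unfold plan
    simp only [Measure.map_add _ _ measurable_snd, pl_snd]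
    ring_nf
    abel

lemma plan_cost {ε p : ℝ} (h0 : 0 < ε) (h4 : ε < 1/4) :
    tCost p (plan ε) = ENNReal.ofReal ((1/2) ^ p * (1 - 4 * ε) + (1/2 - ε) ^ p * (4 * ε)) := by
  have hadd : ∀ μ ν : Measure (ℝ × ℝ), tCost p (μ + ν) = tCost p μ + tCost p ν := by
    intro μ ν; unfold tCost; rw [lintegral_add_measure]
  unfold plan
  simp only [hadd, pl_cost, abs_neg]
  have e1 : |1/2 - ε| = 1/2 - ε := abs_of_pos (by linarith)
  have e2 : |(1/2 : ℝ)| = 1/2 := abs_of_pos (by norm_num)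
  rw [e1, e2]
  have k1 : 0 ≤ (1/2 - ε) ^ p := Real.rpow_nonneg (by linarith) _
  have k2 : 0 ≤ (1/2 : ℝ) ^ p := Real.rpow_nonneg (by norm_num) _
  simp only [← ENNReal.ofReal_mul k1, ← ENNReal.ofReal_mul k2]
  have m1 : ∀ d, 0 ≤ d → 0 ≤ (1/2 - ε) ^ p * d := fun d hd => mul_nonneg k1 hd
  have m2 : ∀ d, 0 ≤ d → 0 ≤ (1/2 : ℝ) ^ p * d := fun d hd => mul_nonneg k2 hd
  have n1 := m1 (-(1/2) - (-(1/2) - ε)) (by linarith)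
  have n2 := m2 (-ε - (-(1/2) + ε)) (by linarith)
  have n3 := m1 (0 - (-ε)) (by linarith)
  have n4 := m1 (ε - 0) (by linarith)
  have n5 := m2 (1/2 - ε - ε) (by linarith)
  have n6 := m1 (1/2 + ε - 1/2) (by linarith)
  rw [← ENNReal.ofReal_add n2 n3, ← ENNReal.ofReal_add (by linarith) n4,
    ← ENNReal.ofReal_add (by linarith) n5, ← ENNReal.ofReal_add n1 (by linarith),
    ← ENNReal.ofReal_add (by linarith) n6]
  congr 1
  ring

lemma adm_rho' {ε : ℝ} (h0 : 0 < ε) (h4 : ε < 1/4) : Adm volume (rho ε) (rho' ε) := by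
  refine ⟨rho'_meas ε, rho'_nonneg ε, Eventually.of_forall fun x => ?_, ?_⟩
  · by_cases h : |x| ≤ 1/2 - ε ∨ (1/2 ≤ |x| ∧ |x| ≤ 1/2 + ε)
    · rw [rho_one h0 h4 h, rho'_zero h0 h4 h]; simp
    · rw [rho_zero h0 h4 h, zero_add]; exact rho'_le h0 h4
  · have e1 : ∫⁻ x, ENNReal.ofReal (rho ε x) = densM volume (rho ε) univ := by simp [densM]
    have e2 : ∫⁻ x, ENNReal.ofReal (rho' ε x) = densM volume (rho' ε) univ := by simp [densM]
    obtain ⟨h1, h2⟩ := plan_coupling h0 h4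
    rw [e1, e2, ← h1, ← h2, Measure.map_apply measurable_fst .univ,
      Measure.map_apply measurable_snd .univ]
    simp

lemma dual_eq {ε a b K k : ℝ} (h0 : 0 < ε) (h4 : ε < 1/4) (ha : 0 ≤ a) (hab : a ≤ b) (hkK : k ≤ K)
    (hk : 0 ≤ k) :
    ∫⁻ x, ENNReal.ofReal (phi0 ε a b K k |x|) ∂(densM volume (rho ε)) =
      ∫⁻ x, ENNReal.ofReal (psi0 ε a b K k |x|) ∂(densM volume (rho' ε)) +
        ENNReal.ofReal (K * (1 - 4 * ε) + k * (4 * ε)) := by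
  have hK := hk.trans hkK
  have hm : Measurable (fun x : ℝ => psi0 ε a b K k |x|) := (psi0_meas ε a b K k).comp measurable_abs
  have hn : ∀ x : ℝ, 0 ≤ psi0 ε a b K k |x| := fun x => psi0_nonneg h0 h4 ha hab hkK hk
  rw [dens_rho h0 h4, dens_rho' h0 h4]
  simp only [lintegral_add_measure]
  have i1 := pl_int (-(1/2) - ε) (-(1/2)) (-(1/2 - ε)) k hk (fun x => phi0 ε a b K k |x|) _ hm hn (by
    intro x hx
    rw [abs_of_nonpos (by linarith [hx.1, hx.2]), abs_of_nonpos (by linarith [hx.1, hx.2]),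
      eqC h0 h4 ha hab hkK hk (by linarith [hx.1, hx.2]) (by linarith [hx.1, hx.2])]
    ring_nf)
  have i2 := pl_int (-(1/2) + ε) (-ε) (-(1/2)) K hK (fun x => phi0 ε a b K k |x|) _ hm hn (by
    intro x hx
    rw [abs_of_nonpos (by linarith [hx.1, hx.2]), abs_of_nonpos (by linarith [hx.1, hx.2]),
      eqB h0 h4 ha hab hkK hk (by linarith [hx.1, hx.2]) (by linarith [hx.1, hx.2])]
    ring_nf)
  have i3 := pl_int (-ε) 0 (-(1/2 - ε)) k hk (fun x => phi0 ε a b K k |x|) _ hm hn (by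
    intro x hx
    rw [abs_of_nonpos (by linarith [hx.1, hx.2]), abs_of_nonpos (by linarith [hx.1, hx.2]),
      eqA h0 h4 ha hab hkK hk (by linarith [hx.1, hx.2]) (by linarith [hx.1, hx.2])]
    ring_nf)
  have i4 := pl_int 0 ε (1/2 - ε) k hk (fun x => phi0 ε a b K k |x|) _ hm hn (by
    intro x hx
    rw [abs_of_nonneg (by linarith [hx.1, hx.2]), abs_of_nonneg (by linarith [hx.1, hx.2]),
      eqA h0 h4 ha hab hkK hk (by linarith [hx.1, hx.2]) (by linarith [hx.1, hx.2])])
  have i5 := pl_int ε (1/2 - ε) (1/2) K hK (fun x => phi0 ε a b K k |x|) _ hm hn (by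
    intro x hx
    rw [abs_of_nonneg (by linarith [hx.1, hx.2]), abs_of_nonneg (by linarith [hx.1, hx.2]),
      eqB h0 h4 ha hab hkK hk (by linarith [hx.1, hx.2]) (by linarith [hx.1, hx.2])])
  have i6 := pl_int (1/2) (1/2 + ε) (1/2 - ε) k hk (fun x => phi0 ε a b K k |x|) _ hm hn (by
    intro x hx
    rw [abs_of_nonneg (by linarith [hx.1, hx.2]), abs_of_nonneg (by linarith [hx.1, hx.2]),
      eqC h0 h4 ha hab hkK hk (by linarith [hx.1, hx.2]) (by linarith [hx.1, hx.2])])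
  rw [i1, i2, i3, i4, i5, i6]
  have hV : ENNReal.ofReal (K * (1 - 4 * ε) + k * (4 * ε)) =
      ENNReal.ofReal k * ENNReal.ofReal ε + ENNReal.ofReal K * ENNReal.ofReal (1/2 - 2 * ε)
      + ENNReal.ofReal k * ENNReal.ofReal ε + ENNReal.ofReal k * ENNReal.ofReal ε
      + ENNReal.ofReal K * ENNReal.ofReal (1/2 - 2 * ε) + ENNReal.ofReal k * ENNReal.ofReal ε := by
    simp only [← ENNReal.ofReal_mul hk, ← ENNReal.ofReal_mul hK]
    have n1 : 0 ≤ k * ε := by positivity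
    have n2 : 0 ≤ K * (1/2 - 2 * ε) := mul_nonneg hK (by linarith)
    repeat rw [← ENNReal.ofReal_add (by linarith) (by linarith)]
    congr 1; ring
  rw [hV]
  rw [show -(1/2) - ε + -(1/2 - ε) = (-1 : ℝ) by ring, show -(1/2) + -(1/2 - ε) = -1 + ε by ring,
    show -(1/2) + ε + -(1/2) = -1 + ε by ring, show -ε + -(1/2) = -(1/2) - ε by ring,
    show -ε + -(1/2 - ε) = -(1/2) by ring, show 0 + -(1/2 - ε) = -(1/2) + ε by ring,
    show 0 + (1/2 - ε) = 1/2 - ε by ring, show ε + (1/2 - ε) = 1/2 by ring,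
    show ε + 1/2 = 1/2 + ε by ring, show 1/2 - ε + 1/2 = 1 - ε by ring,
    show 1/2 + (1/2 - ε) = 1 - ε by ring, show 1/2 + ε + (1/2 - ε) = 1 by ring,
    show -(1/2) - (-(1/2) - ε) = ε by ring, show -ε - (-(1/2) + ε) = 1/2 - 2 * ε by ring,
    show 0 - -ε = ε by ring, show ε - 0 = ε by ring, show 1/2 - ε - ε = 1/2 - 2 * ε by ring,
    show 1/2 + ε - 1/2 = ε by ring]
  abel

lemma ae_compl_pts (ε : ℝ) : ∀ᵐ x : ℝ, |x| ≠ 1/2 - ε ∧ |x| ≠ 1/2 ∧ |x| ≠ 1/2 + ε ∧ |x| ≠ 1 := by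
  have h : ∀ c : ℝ, ∀ᵐ x : ℝ, |x| ≠ c := by
    intro c
    have h1 : ∀ᵐ x : ℝ, x ≠ c := by simp [ae_iff]
    have h2 : ∀ᵐ x : ℝ, x ≠ -c := by simp [ae_iff]
    filter_upwards [h1, h2] with x a b
    intro h
    rcases abs_cases x with hx | hx
    · exact a (by linarith)
    · exact b (by linarith)
  filter_upwards [h (1/2 - ε), h (1/2), h (1/2 + ε), h 1] with x a b c d
  exact ⟨a, b, c, d⟩

lemma lower {ε p : ℝ} (hp : 1 < p) (h0 : 0 < ε) (h4 : ε < (p - 1) / (4 * p)) (r : ℝ → ℝ)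
    (hr : Adm volume (rho ε) r) (π : Measure (ℝ × ℝ))
    (hπ : IsCoupling π (densM volume (rho ε)) (densM volume r)) :
    ENNReal.ofReal ((1/2) ^ p * (1 - 4 * ε) + (1/2 - ε) ^ p * (4 * ε)) ≤ tCost p π := by
  have hp0 : 0 < p := by linarith
  have hpe : 1 ≤ p * (1 - 4 * ε) := by
    rw [lt_div_iff₀ (by linarith)] at h4
    linarith
  have h4 : ε < 1/4 := by nlinarith
  set K : ℝ := (1/2) ^ p with hKd
  set k : ℝ := (1/2 - ε) ^ p with hkd
  set a : ℝ := p * (1/2 - ε) ^ (p - 1) with had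
  set b : ℝ := p * (1/2) ^ (p - 1) with hbd
  have ha : 0 ≤ a := mul_nonneg hp0.le (Real.rpow_nonneg (by linarith) _)
  have hab : a ≤ b := mul_le_mul_of_nonneg_left
    (Real.rpow_le_rpow (by linarith) (by linarith) (by linarith)) hp0.le
  have hk : 0 ≤ k := Real.rpow_nonneg (by linarith) _
  have hkK : k ≤ K := Real.rpow_le_rpow (by linarith) (by linarith) hp0.le
  have hb : b = 2 * p * K := by
    have : K = (1/2) ^ (p - 1) * (1/2 : ℝ) := by
      rw [hKd, ← Real.rpow_add_one (by norm_num)]; ring_nf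
    rw [this, hbd]; ring
  have hbad : 2 * k - K ≤ b * (1/2 - 2 * ε) := by
    have : K * 1 ≤ K * (p * (1 - 4 * ε)) := mul_le_mul_of_nonneg_left hpe (hk.trans hkK)
    rw [hb]; linarith
  have hkey : ∀ x y : ℝ, (|x| ≤ 1/2 - ε ∨ (1/2 ≤ |x| ∧ |x| ≤ 1/2 + ε)) →
      ((1/2 - ε ≤ |y| ∧ |y| ≤ 1/2) ∨ 1/2 + ε ≤ |y|) →
      phi0 ε a b K k |x| ≤ dist x y ^ p + psi0 ε a b K k |y| := by
    intro x y hx hy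
    have := key h0 h4 ha hab hkK hk (fun u => |u| ^ p) (fun u => by positivity)
      (fun u => by
        have := tangent p (1/2) |u| hp (by norm_num) (abs_nonneg u)
        have h2 := mul_le_mul_of_nonneg_left (le_abs_self u) (ha.trans hab)
        linarith)
      (fun u => by
        have := tangent p (1/2 - ε) |u| hp (by linarith) (abs_nonneg u)
        have h2 := mul_le_mul_of_nonneg_left (le_abs_self u) ha
        linarith) hbad hx hy
    refine this.trans ?_
    gcongr
    rw [dist_comm, Real.dist_eq]
    exact abs_abs_sub_abs_le_abs_sub y x
  obtain ⟨hrm, hr0, hr1, -⟩ := hr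
  have hφm : Measurable (fun x : ℝ => phi0 ε a b K k |x|) := (phi0_meas ε a b K k).comp measurable_abs
  have hψm : Measurable (fun x : ℝ => psi0 ε a b K k |x|) := (psi0_meas ε a b K k).comp measurable_abs
  have hψ0 : ∀ x : ℝ, 0 ≤ psi0 ε a b K k |x| := fun x => psi0_nonneg h0 h4 ha hab hkK hk
  have hX : ∀ᵐ z ∂π, |z.1| ≤ 1/2 - ε ∨ (1/2 ≤ |z.1| ∧ |z.1| ≤ 1/2 + ε) := by
    have : ∀ᵐ x ∂(densM volume (rho ε)), |x| ≤ 1/2 - ε ∨ (1/2 ≤ |x| ∧ |x| ≤ 1/2 + ε) := by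
      unfold densM
      rw [ae_withDensity_iff (rho_meas ε).ennreal_ofReal]
      refine Eventually.of_forall fun x hx => ?_
      by_contra hc
      exact hx (by simp [rho_zero h0 h4 hc])
    rw [← hπ.1] at this
    exact ae_of_ae_map measurable_fst.aemeasurable this
  have hY : ∀ᵐ z ∂π, (1/2 - ε ≤ |z.2| ∧ |z.2| ≤ 1/2) ∨ 1/2 + ε ≤ |z.2| := by
    have : ∀ᵐ y ∂(densM volume r), (1/2 - ε ≤ |y| ∧ |y| ≤ 1/2) ∨ 1/2 + ε ≤ |y| := by
      unfold densM
      rw [ae_withDensity_iff hrm.ennreal_ofReal]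
      filter_upwards [hr1] with y hy hne
      by_contra hc
      push Not at hc
      apply hne
      rw [rho_one h0 h4] at hy
      · simp; linarith
      · by_cases h : |y| ≤ 1/2 - ε
        · exact Or.inl h
        · exact Or.inr ⟨(hc.1 (not_le.1 h).le).le, hc.2.le⟩
    rw [← hπ.2] at this
    exact ae_of_ae_map measurable_snd.aemeasurable this
  have step1 : ∫⁻ x, ENNReal.ofReal (phi0 ε a b K k |x|) ∂(densM volume (rho ε)) ≤
      tCost p π + ∫⁻ x, ENNReal.ofReal (psi0 ε a b K k |x|) ∂(densM volume r) := by
    rw [← hπ.1, ← hπ.2, lintegral_map hφm.ennreal_ofReal measurable_fst,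
      lintegral_map hψm.ennreal_ofReal measurable_snd]
    unfold tCost
    have hm2 : Measurable (fun z : ℝ × ℝ => ENNReal.ofReal (psi0 ε a b K k |z.2|)) :=
      hψm.ennreal_ofReal.comp measurable_snd
    rw [← lintegral_add_right _ hm2]
    apply lintegral_mono_ae
    filter_upwards [hX, hY] with z h1 h2
    rw [← ENNReal.ofReal_add (by positivity) (hψ0 _)]
    exact ENNReal.ofReal_le_ofReal (hkey _ _ h1 h2)
  have step2 : ∫⁻ x, ENNReal.ofReal (psi0 ε a b K k |x|) ∂(densM volume r) ≤
      ∫⁻ x, ENNReal.ofReal (psi0 ε a b K k |x|) ∂(densM volume (rho' ε)) := by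
    unfold densM
    rw [lintegral_withDensity_eq_lintegral_mul _ hrm.ennreal_ofReal hψm.ennreal_ofReal,
      lintegral_withDensity_eq_lintegral_mul _ (rho'_meas ε).ennreal_ofReal hψm.ennreal_ofReal]
    apply lintegral_mono_ae
    filter_upwards [hr1, ae_compl_pts ε] with x hx hpt
    simp only [Pi.mul_apply]
    by_cases h1 : 1 ≤ |x|
    · simp [psi0_zero h0 h4 ha hab hkK hk h1]
    gcongr
    by_cases h : |x| ≤ 1/2 - ε ∨ (1/2 ≤ |x| ∧ |x| ≤ 1/2 + ε)
    · rw [rho_one h0 h4 h] at hx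
      linarith [rho'_nonneg ε x]
    · rw [rho_zero h0 h4 h] at hx
      rw [rho'_one h0 h4]
      · linarith
      · push Not at h
        by_cases h2 : 1/2 ≤ |x|
        · exact Or.inr ⟨h.2 h2, not_le.1 h1⟩
        · exact Or.inl ⟨h.1, not_le.1 h2⟩
  have fin : ∫⁻ x, ENNReal.ofReal (psi0 ε a b K k |x|) ∂(densM volume (rho' ε)) ≠ ⊤ := by
    have hu : densM volume (rho' ε) univ = 1 := by
      have := (adm_rho' h0 h4).2.2.2
      rw [lint_rho h0 h4] at this
      simpa [densM] using this
    refine ne_top_of_le_ne_top (b := ∫⁻ x, ENNReal.ofReal (a + K + 2 * b) ∂(densM volume (rho' ε))) ?_ ?_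
    · simp [hu]
    · exact lintegral_mono fun x => ENNReal.ofReal_le_ofReal
        (psi0_le h0 h4 ha hab hkK hk (abs_nonneg x))
  rw [dual_eq h0 h4 ha hab hkK hk, add_comm] at step1
  have := step1.trans (add_le_add le_rfl step2)
  exact (ENNReal.add_le_add_iff_right fin).1 this

end PertInt

/-- The energy of the perturbed interval
`ρ_ε = χ_{[-1/2-ε,-1/2]} + χ_{[-1/2+ε,1/2-ε]} + χ_{[1/2,1/2+ε]}`:
for small `ε > 0` one has `ρ_ε ∈ A` and
`𝒲_p(ρ_ε)^p = 2^{-p} - 4ε(2^{-p} - (1/2-ε)^p)`. -/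
theorem energy_of_perturbed_interval (p : ℝ) (hp : 1 < p) :
    ∃ ε₀ : ℝ, 0 < ε₀ ∧ ∀ ε : ℝ, 0 < ε → ε < ε₀ →
      memA volume 1
        (fun x : ℝ =>
          (Set.Icc (-(1/2) - ε) (-(1/2))).indicator (fun _ => (1 : ℝ)) x +
          (Set.Icc (-(1/2) + ε) (1/2 - ε)).indicator (fun _ => (1 : ℝ)) x +
          (Set.Icc (1/2 : ℝ) (1/2 + ε)).indicator (fun _ => (1 : ℝ)) x) ∧
      WEnergyPow p volume
        (fun x : ℝ =>
          (Set.Icc (-(1/2) - ε) (-(1/2))).indicator (fun _ => (1 : ℝ)) x +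
          (Set.Icc (-(1/2) + ε) (1/2 - ε)).indicator (fun _ => (1 : ℝ)) x +
          (Set.Icc (1/2 : ℝ) (1/2 + ε)).indicator (fun _ => (1 : ℝ)) x) =
        ENNReal.ofReal ((2 : ℝ) ^ (-p) - 4 * ε * ((2 : ℝ) ^ (-p) - (1/2 - ε) ^ p)) := by
  refine ⟨(p - 1) / (4 * p), div_pos (by linarith) (by linarith), fun ε h0 hε => ?_⟩
  have h4 : ε < 1/4 := by
    refine hε.trans_le ?_
    rw [div_le_div_iff₀ (by linarith) (by norm_num)]
    linarith
  refine ⟨PertInt.memA_rho h0 h4, ?_⟩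
  have hV : (2 : ℝ) ^ (-p) - 4 * ε * ((2 : ℝ) ^ (-p) - (1/2 - ε) ^ p) =
      (1/2) ^ p * (1 - 4 * ε) + (1/2 - ε) ^ p * (4 * ε) := by
    have : (2 : ℝ) ^ (-p) = (1/2) ^ p := by
      rw [Real.rpow_neg (by norm_num), ← Real.inv_rpow (by norm_num)]; norm_num
    rw [this]; ring
  rw [hV]
  change WEnergyPow p volume (PertInt.rho ε) = _
  apply le_antisymm
  · rw [← PertInt.plan_cost h0 h4]
    unfold WEnergyPow WpPow
    exact (iInf₂_le _ (PertInt.adm_rho' h0 h4)).trans 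
      (iInf₂_le (PertInt.plan ε) (PertInt.plan_coupling h0 h4))
  · unfold WEnergyPow WpPow
    exact le_iInf₂ fun r hr => le_iInf₂ fun π hπ => PertInt.lower hp h0 hε r hr π hπ
end
end
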